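/- Let Y ⊆ X be simplicial complexes with a set of bad simplices in X − Y satisfying conditions (1) and (2) of the link argument. If X is n-connected and for every bad simplex σ the complex G_σ of simplices good for σ is (n − dim σ)-connected, then Y is n-connected. -/

import Mathlib

open scoped BigOperators

structure ASC (V : Type) where
  faces : Set (Finset V)
  nonempty_of_mem : ∀ ⦃s⦄, s ∈ faces → s.Nonempty
  down_closed : ∀ ⦃s t : Finset V⦄, s ∈ faces → t ⊆ s → t.Nonempty → t ∈ faces

namespace ASC

variable {V W : Type} [DecidableEq V] [DecidableEq W]

/-- The geometric realization of an abstract simplicial complex, as a subset of `V → ℝ`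
(barycentric coordinates, with the product topology on the subtype). -/
def space (K : ASC V) : Set (V → ℝ) :=
  {x | (∀ v, 0 ≤ x v) ∧ ∃ s ∈ K.faces, (∀ v, v ∉ s → x v = 0) ∧ ∑ v ∈ s, x v = 1}

/-- A vertex map is simplicial if it sends faces to faces. -/
def IsSimplicial (K : ASC V) (L : ASC W) (φ : V → W) : Prop :=
  ∀ s ∈ K.faces, s.image φ ∈ L.faces

/-- The map induced on geometric realizations by a vertex map. -/
noncomputable def push (φ : V → W) (x : V → ℝ) : W → ℝ :=
  fun w => ∑ᶠ v ∈ φ ⁻¹' {w}, x v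

/-- The link of a simplex. -/
def link (K : ASC V) (σ : Finset V) : ASC V where
  faces := {t | t ∈ K.faces ∧ Disjoint σ t ∧ σ ∪ t ∈ K.faces}
  nonempty_of_mem := fun _ ht => K.nonempty_of_mem ht.1
  down_closed := by
    rintro t u ⟨h1, h2, h3⟩ hsub hne
    exact ⟨K.down_closed h1 hsub hne, h2.mono_right hsub,
      K.down_closed h3 (Finset.union_subset_union_right hsub)
        ⟨hne.choose, Finset.mem_union_right _ hne.choose_spec⟩⟩

end ASC

/-- `n`-connectedness of a space (`n` an integer): nonempty when `n ≥ -1`, and all homotopy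
groups in dimensions `≤ n` vanish, at every basepoint. -/
def IsConn (X : Type) [TopologicalSpace X] (n : ℤ) : Prop :=
  (-1 ≤ n → Nonempty X) ∧
    ∀ i : ℕ, (i : ℤ) ≤ n → ∀ x : X, Subsingleton (HomotopyGroup (Fin i) X x)

/-- The subcomplex `G_σ` of the link of a bad simplex `σ`, consisting of the simplices `τ`
that are good for `σ`: every bad face of `τ ∗ σ` is contained in `σ`. -/
def goodFor {V : Type} [DecidableEq V] (K : ASC V) (Bad : Set (Finset V)) (σ : Finset V) :
    ASC V where
  faces := {t | t ∈ (K.link σ).faces ∧ ∀ u, u ⊆ t ∪ σ → u.Nonempty → u ∈ Bad → u ⊆ σ}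
  nonempty_of_mem := fun _ h => (K.link σ).nonempty_of_mem h.1
  down_closed := by
    rintro t u ⟨ht1, ht2⟩ hsub hne
    exact ⟨(K.link σ).down_closed ht1 hsub hne,
      fun w hw hwne hwb => ht2 w (hw.trans (Finset.union_subset_union_left hsub)) hwne hwb⟩

open Set Metric Topology

/-- Every map from the boundary of the `d`-cube `[-1, 1]^d` to `C` extends over the cube. -/
def SphereExt {Y : Type} [TopologicalSpace Y] (C : Set Y) (d : ℕ) : Prop :=
  ∀ u : (Fin d → ℝ) → Y, ContinuousOn u (sphere 0 1) → MapsTo u (sphere 0 1) C →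
    ∃ F : (Fin d → ℝ) → Y, ContinuousOn F (closedBall 0 1) ∧ MapsTo F (closedBall 0 1) C ∧
      EqOn F u (sphere 0 1)

theorem exists_extension_of_homotopy {Y : Type} [TopologicalSpace Y] {C : Set Y} {d : ℕ}
    (h : ℝ → (Fin d → ℝ) → Y)
    (hc : ContinuousOn (fun p : ℝ × (Fin d → ℝ) => h p.1 p.2) (Icc 0 1 ×ˢ sphere 0 1))
    (hC : ∀ s ∈ Icc (0 : ℝ) 1, ∀ z ∈ sphere (0 : Fin d → ℝ) 1, h s z ∈ C)
    (G : (Fin d → ℝ) → Y) (hG : ContinuousOn G (closedBall 0 1))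
    (hGC : MapsTo G (closedBall 0 1) C) (hG1 : EqOn G (h 1) (sphere 0 1)) :
    ∃ F : (Fin d → ℝ) → Y, ContinuousOn F (closedBall 0 1) ∧ MapsTo F (closedBall 0 1) C ∧
      EqOn F (h 0) (sphere 0 1) := by
  classical
  have key : ∀ x : Fin d → ℝ, ‖x‖ ≤ 1 → ¬ ‖x‖ < 1 / 2 →
      (2 - 2 * ‖x‖, ‖x‖⁻¹ • x) ∈ (Icc 0 1 ×ˢ sphere 0 1 : Set (ℝ × (Fin d → ℝ))) := by
    intro x hx hx2
    have hx0 : ‖x‖ ≠ 0 := by linarith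
    refine ⟨⟨by simp; linarith, by simp; linarith⟩, ?_⟩
    simp [norm_smul, inv_mul_cancel₀ hx0]
  refine ⟨fun x => if ‖x‖ ≤ 1 / 2 then G ((2 : ℝ) • x) else h (2 - 2 * ‖x‖) (‖x‖⁻¹ • x),
    ?_, ?_, ?_⟩
  · refine ContinuousOn.if ?_ ?_ ?_
    · rintro x ⟨hx, hf⟩
      have hx2 : ‖x‖ = 1 / 2 := frontier_le_subset_eq continuous_norm continuous_const hf
      have : (2 : ℝ) • x ∈ sphere (0 : Fin d → ℝ) 1 := by simp [norm_smul, hx2]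
      rw [hG1 this, hx2]
      norm_num
    · refine hG.comp (by fun_prop) ?_
      rintro x ⟨_, hx⟩
      rw [(isClosed_le continuous_norm continuous_const).closure_eq] at hx
      have hx : ‖x‖ ≤ 1 / 2 := hx
      simp [norm_smul]; linarith
    · have hs : ∀ x ∈ closedBall (0 : Fin d → ℝ) 1 ∩ closure {a | ¬ ‖a‖ ≤ 1 / 2},
          ‖x‖ ≤ 1 ∧ ¬ ‖x‖ < 1 / 2 := by
        rintro x ⟨hx, hx2⟩
        refine ⟨by simpa using hx, ?_⟩
        have : closure {a : Fin d → ℝ | ¬ ‖a‖ ≤ 1 / 2} ⊆ {a | 1 / 2 ≤ ‖a‖} :=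
          closure_minimal (fun a ha => by
            simp only [mem_ofPred_eq] at *; linarith) (isClosed_le continuous_const continuous_norm)
        exact not_lt.2 (this hx2)
      refine hc.comp (f := fun x : Fin d → ℝ => (2 - 2 * ‖x‖, ‖x‖⁻¹ • x)) ?_
        (fun x hx => key x (hs x hx).1 (hs x hx).2)
      refine ContinuousOn.prodMk (by fun_prop) (ContinuousOn.fun_smul ?_ (continuousOn_id' _))
      refine continuous_norm.continuousOn.inv₀ (fun x hx => ?_)
      have := (hs x hx).2
      intro h0
      simp [h0] at this
  · intro x hx
    have hx1 : ‖x‖ ≤ 1 := by simpa using hx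
    by_cases hx2 : ‖x‖ ≤ 1 / 2
    · simp only [hx2, if_true]
      apply hGC
      simp [norm_smul]; linarith
    · simp only [hx2, if_false]
      have := key x hx1 (by linarith)
      exact hC _ this.1 _ this.2
  · intro x hx
    have hx1 : ‖x‖ = 1 := by simpa using hx
    simp only [hx1]
    norm_num

theorem norm_eq_max_tail {d : ℕ} (z : Fin (d + 1) → ℝ) :
    ‖z‖ = max |z 0| ‖fun i : Fin d => z i.succ‖ := by
  apply le_antisymm
  · refine (pi_norm_le_iff_of_nonneg (by positivity)).2 (fun i => ?_)
    refine Fin.cases ?_ (fun j => ?_) i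
    · exact le_max_left _ _
    · exact le_max_of_le_right (norm_le_pi_norm (fun i : Fin d => z i.succ) j)
  · refine max_le (norm_le_pi_norm z 0) ((pi_norm_le_iff_of_nonneg (norm_nonneg _)).2 ?_)
    exact fun i => norm_le_pi_norm z i.succ

theorem exists_abs_eq_one {d : ℕ} {z : Fin d → ℝ} (hz : ‖z‖ = 1) : ∃ i, |z i| = 1 := by
  by_contra! hne
  have : ‖z‖ < 1 := (pi_norm_lt_iff one_pos).2 (fun i =>
    lt_of_le_of_ne (hz ▸ norm_le_pi_norm z i) (hne i))
  linarith

/-- A latitude on the boundary of the cube: it is `‖z'‖` on the face `z 0 = 1`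
and `1` on the other faces. -/
noncomputable def latitude {d : ℕ} (z : Fin (d + 1) → ℝ) : ℝ :=
  min 1 (‖fun i : Fin d => z i.succ‖ + (1 - z 0))

/-- A homotopy of maps which, after normalization, collapses all faces of the cube other than
`z 0 = 1` to a point. -/
noncomputable def pinch {d : ℕ} (s : ℝ) (z : Fin (d + 1) → ℝ) : Fin (d + 1) → ℝ :=
  Fin.cons ((1 - s) * z 0 + s * (1 - 2 * latitude z)) (fun i => (1 - s * latitude z) * z i.succ)

theorem continuous_pinch {d : ℕ} :
    Continuous (fun p : ℝ × (Fin (d + 1) → ℝ) => pinch p.1 p.2) := by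
  unfold pinch latitude
  refine continuous_pi (fun i => ?_)
  refine Fin.cases ?_ (fun j => ?_) i
  · simp only [Fin.cons_zero]; fun_prop
  · simp only [Fin.cons_succ]; fun_prop

theorem pinch_zero {d : ℕ} (z : Fin (d + 1) → ℝ) : pinch 0 z = z := by
  ext i
  refine Fin.cases ?_ (fun j => ?_) i <;> simp [pinch]

theorem pinch_one_of_latitude {d : ℕ} {z : Fin (d + 1) → ℝ} (h : latitude z = 1) :
    pinch 1 z = Fin.cons (-1) 0 := by
  ext i
  refine Fin.cases ?_ (fun j => ?_) i
  · simp [pinch, h]; norm_num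
  · simp [pinch, h]

theorem latitude_eq_one {d : ℕ} {z : Fin (d + 1) → ℝ} (hz : ‖z‖ = 1)
    (h : z 0 = -1 ∨ ‖fun i : Fin d => z i.succ‖ = 1) : latitude z = 1 := by
  have h0 : |z 0| ≤ 1 := hz ▸ norm_le_pi_norm z 0
  have := abs_le.1 h0
  have hn := norm_nonneg (fun i : Fin d => z i.succ)
  unfold latitude
  apply min_eq_left
  rcases h with h | h
  · rw [h]; linarith
  · rw [h]; linarith

theorem sphere_cases {d : ℕ} {z : Fin (d + 1) → ℝ} (hz : ‖z‖ = 1) :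
    z 0 = 1 ∨ z 0 = -1 ∨ ‖fun i : Fin d => z i.succ‖ = 1 := by
  rw [norm_eq_max_tail] at hz
  rcases max_choice |z 0| ‖fun i : Fin d => z i.succ‖ with h | h
  · rw [h] at hz
    rcases eq_or_eq_neg_of_abs_eq hz with h | h
    · exact Or.inl h
    · exact Or.inr (Or.inl h)
  · rw [h] at hz
    exact Or.inr (Or.inr hz)

theorem pinch_ne_zero {d : ℕ} {z : Fin (d + 1) → ℝ} (hz : ‖z‖ = 1) {s : ℝ}
    (hs : s ∈ Icc (0 : ℝ) 1) : pinch s z ≠ 0 := by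
  intro h0
  have e0 : (1 - s) * z 0 + s * (1 - 2 * latitude z) = 0 := by
    simpa [pinch] using congrFun h0 0
  have e1 : (1 - s * latitude z) * ‖fun i : Fin d => z i.succ‖ = 0 := by
    have hf : (1 - s * latitude z) • (fun i : Fin d => z i.succ) = 0 := by
      ext i
      simpa [pinch] using congrFun h0 i.succ
    have := congrArg norm hf
    rw [norm_smul, norm_zero] at this
    rcases mul_eq_zero.1 this with h | h
    · rw [norm_eq_zero.1 h, zero_mul]
    · rw [h, mul_zero]
  obtain ⟨hs0, hs1⟩ := hs
  by_cases hlat : latitude z = 1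
  · rw [hlat] at e0 e1
    rcases mul_eq_zero.1 e1 with h | h
    · have : s = 1 := by linarith
      subst this; linarith
    · have hz0 : z 0 = 1 ∨ z 0 = -1 := by
        rcases sphere_cases hz with h' | h' | h'
        · exact Or.inl h'
        · exact Or.inr h'
        · rw [h] at h'; norm_num at h'
      rcases hz0 with hz0 | hz0
      · unfold latitude at hlat
        rw [h, hz0] at hlat
        norm_num at hlat
      · rw [hz0] at e0; linarith
  · have hz0 : z 0 = 1 := by
      rcases sphere_cases hz with h' | h' | h'
      · exact h'
      · exact absurd (latitude_eq_one hz (Or.inl h')) hlat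
      · exact absurd (latitude_eq_one hz (Or.inr h')) hlat
    have hl : latitude z = ‖fun i : Fin d => z i.succ‖ := by
      unfold latitude at hlat ⊢
      rw [hz0] at hlat ⊢
      rcases min_choice 1 (‖fun i : Fin d => z i.succ‖ + (1 - 1)) with h | h
      · exact absurd h hlat
      · rw [h]; ring
    have hlt : latitude z < 1 := lt_of_le_of_ne (min_le_left _ _) hlat
    have hl0 : 0 ≤ latitude z := hl ▸ norm_nonneg _
    rw [← hl] at e1
    rw [hz0] at e0
    rcases mul_eq_zero.1 e1 with h | h
    · nlinarith
    · rw [h] at e0; linarith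

/-- The affine map `[-1, 1] → [0, 1]`, extended to a retraction. -/
noncomputable def toUnit (a : ℝ) : unitInterval := projIcc 0 1 zero_le_one ((1 + a) / 2)

theorem continuous_toUnit : Continuous toUnit := by
  unfold toUnit
  exact continuous_projIcc.comp (by fun_prop)

theorem toUnit_one : toUnit 1 = 1 := by simp [toUnit]

theorem toUnit_neg_one : toUnit (-1) = 0 := by simp [toUnit]

theorem toUnit_mem_boundary {d : ℕ} {z : Fin d → ℝ} (hz : ‖z‖ = 1) :
    (fun i => toUnit (z i)) ∈ Cube.boundary (Fin d) := by
  obtain ⟨i, hi⟩ := exists_abs_eq_one hz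
  refine ⟨i, ?_⟩
  rcases eq_or_eq_neg_of_abs_eq hi with h | h
  · right; simp [h, toUnit_one]
  · left; simp [h, toUnit_neg_one]

theorem toUnit_two_mul_sub (y : unitInterval) : toUnit (2 * (y : ℝ) - 1) = y := by
  unfold toUnit
  convert projIcc_val zero_le_one y using 2
  ring

theorem two_mul_toUnit_sub {a : ℝ} (ha : |a| ≤ 1) : 2 * (toUnit a : ℝ) - 1 = a := by
  have := abs_le.1 ha
  unfold toUnit
  rw [projIcc_of_mem zero_le_one (x := (1 + a) / 2) ⟨by linarith, by linarith⟩]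
  ring

theorem norm_two_mul_sub_le {d : ℕ} (y : Fin d → unitInterval) :
    ‖fun i => 2 * (y i : ℝ) - 1‖ ≤ 1 := by
  refine (pi_norm_le_iff_of_nonneg zero_le_one).2 (fun i => ?_)
  have := (y i).2
  rw [Real.norm_eq_abs, abs_le]
  constructor <;> linarith [this.1, this.2]

theorem norm_two_mul_sub_of_mem_boundary {d : ℕ} {y : Fin d → unitInterval}
    (hy : y ∈ Cube.boundary (Fin d)) : ‖fun i => 2 * (y i : ℝ) - 1‖ = 1 := by
  apply le_antisymm (norm_two_mul_sub_le y)
  obtain ⟨i, hi⟩ := hy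
  refine le_trans ?_ (norm_le_pi_norm _ i)
  rcases hi with h | h
  · simp [h]
  · simp [h]; norm_num

theorem GenLoop.exists_homotopy {X : Type} [TopologicalSpace X] {d : ℕ} {x : X}
    [h : Subsingleton (HomotopyGroup (Fin d) X x)] (f g : GenLoop (Fin d) X x) :
    Nonempty (f.1.HomotopyRel g.1 (Cube.boundary (Fin d))) :=
  Quotient.exact (s := GenLoop.Homotopic.setoid (Fin d) x)
    (Subsingleton.elim (α := HomotopyGroup (Fin d) X x) (Quotient.mk _ f) (Quotient.mk _ g))

theorem sphere_fin_zero : sphere (0 : Fin 0 → ℝ) 1 = ∅ := by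
  refine eq_empty_iff_forall_notMem.2 (fun z hz => ?_)
  rw [mem_sphere_zero_iff_norm, Subsingleton.elim z 0, norm_zero] at hz
  exact zero_ne_one hz

theorem sphereExt_zero {Y : Type} [TopologicalSpace Y] {C : Set Y} (h : C.Nonempty) :
    SphereExt C 0 := by
  intro u _ _
  obtain ⟨c, hc⟩ := h
  refine ⟨fun _ => c, continuousOn_const, fun _ _ => hc, fun z hz => ?_⟩
  exact absurd (sphere_fin_zero ▸ hz) (notMem_empty z)

theorem sphereExt_succ {Y : Type} [TopologicalSpace Y] {C : Set Y} {d : ℕ}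
    (h : ∀ x : C, Subsingleton (HomotopyGroup (Fin d) C x)) : SphereExt C (d + 1) := by
  intro u hu huC
  set q : ℝ → (Fin (d + 1) → ℝ) → (Fin (d + 1) → ℝ) := fun s z => ‖pinch s z‖⁻¹ • pinch s z
    with hq
  have hqs : ∀ s ∈ Icc (0 : ℝ) 1, ∀ z ∈ sphere (0 : Fin (d + 1) → ℝ) 1,
      q s z ∈ sphere (0 : Fin (d + 1) → ℝ) 1 := by
    intro s hs z hz
    have := norm_ne_zero_iff.2 (pinch_ne_zero (by simpa using hz) hs)
    simp [hq, norm_smul, inv_mul_cancel₀ this]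
  have hqc : ContinuousOn (fun p : ℝ × (Fin (d + 1) → ℝ) => q p.1 p.2)
      (Icc 0 1 ×ˢ sphere 0 1) := by
    refine ContinuousOn.fun_smul (ContinuousOn.inv₀ continuous_pinch.norm.continuousOn ?_)
      continuous_pinch.continuousOn
    rintro ⟨s, z⟩ ⟨hs, hz⟩
    exact norm_ne_zero_iff.2 (pinch_ne_zero (by simpa using hz) hs)
  set p : Fin (d + 1) → ℝ := Fin.cons (-1) 0 with hp
  have hpn : ‖p‖ = 1 := by
    rw [norm_eq_max_tail]
    have : (fun i : Fin d => p i.succ) = 0 := by ext i; simp [hp]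
    rw [this]; simp [hp]
  have hq1 : ∀ z : Fin (d + 1) → ℝ, latitude z = 1 → q 1 z = p := by
    intro z hz
    simp only [hq, pinch_one_of_latitude hz]
    rw [← hp, hpn]; simp
  have hq0 : ∀ z ∈ sphere (0 : Fin (d + 1) → ℝ) 1, q 0 z = z := by
    intro z hz
    have : ‖z‖ = 1 := by simpa using hz
    simp [hq, pinch_zero, this]
  have hpS : p ∈ sphere (0 : Fin (d + 1) → ℝ) 1 := by simp [hpn]
  set top : (Fin d → unitInterval) → (Fin (d + 1) → ℝ) :=
    fun y => Fin.cons 1 (fun i => 2 * (y i : ℝ) - 1) with htop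
  have htopS : ∀ y, top y ∈ sphere (0 : Fin (d + 1) → ℝ) 1 := by
    intro y
    rw [mem_sphere_zero_iff_norm, norm_eq_max_tail]
    simpa [htop] using norm_two_mul_sub_le y
  have htopc : Continuous top := by
    refine continuous_pi (fun i => ?_)
    refine Fin.cases ?_ (fun j => ?_) i
    · simp only [htop, Fin.cons_zero]; fun_prop
    · simp only [htop, Fin.cons_succ]; fun_prop
  have hone : (1 : ℝ) ∈ Icc (0 : ℝ) 1 := ⟨zero_le_one, le_rfl⟩
  have hq1c : ContinuousOn (q 1) (sphere 0 1) :=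
    hqc.comp (f := fun z => ((1 : ℝ), z)) (by fun_prop) (fun z hz => ⟨hone, hz⟩)
  let x0 : C := ⟨u p, huC hpS⟩
  let f : GenLoop (Fin d) C x0 :=
    ⟨⟨fun y => ⟨u (q 1 (top y)), huC (hqs 1 hone _ (htopS y))⟩, by
      refine Continuous.subtype_mk ?_ _
      exact (hu.comp hq1c (hqs 1 hone)).comp_continuous htopc htopS⟩, by
      intro y hy
      apply Subtype.ext
      change u (q 1 (top y)) = u p
      rw [hq1]
      apply latitude_eq_one (by simpa using htopS y)
      right
      simpa [htop] using norm_two_mul_sub_of_mem_boundary hy⟩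
  have := h x0
  obtain ⟨H⟩ := GenLoop.exists_homotopy f GenLoop.const
  set G : (Fin (d + 1) → ℝ) → Y :=
    fun z => (H (toUnit (-z 0), fun i => toUnit (z i.succ)) : C) with hG
  have hGc : Continuous G := by
    refine continuous_subtype_val.comp (H.continuous.comp ?_)
    refine Continuous.prodMk (continuous_toUnit.comp (by fun_prop)) (continuous_pi fun i => ?_)
    exact continuous_toUnit.comp (by fun_prop)
  have hG1 : EqOn G (fun z => u (q 1 z)) (sphere 0 1) := by
    intro z hz
    have hz1 : ‖z‖ = 1 := by simpa using hz
    have hzi : ∀ i, |z i| ≤ 1 := fun i => hz1 ▸ norm_le_pi_norm z i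
    rcases sphere_cases hz1 with h1 | h1 | h1
    · have e : top (fun i => toUnit (z i.succ)) = z := by
        ext i
        refine Fin.cases ?_ (fun j => ?_) i
        · simp [htop, h1]
        · simp only [htop, Fin.cons_succ]
          exact two_mul_toUnit_sub (hzi _)
      have : G z = u (q 1 (top (fun i => toUnit (z i.succ)))) := by
        simp only [hG, h1, toUnit_neg_one]
        rw [H.apply_zero]
        rfl
      rw [this, e]
    · have : G z = u p := by
        simp only [hG, h1, neg_neg, toUnit_one]
        rw [H.apply_one]
        rfl
      rw [this]
      simp only [hq1 z (latitude_eq_one hz1 (Or.inl h1))]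
    · have hb := toUnit_mem_boundary h1
      have : G z = u p := by
        simp only [hG]
        rw [H.eq_fst _ hb]
        exact congrArg Subtype.val (f.2 _ hb)
      rw [this]
      simp only [hq1 z (latitude_eq_one hz1 (Or.inr h1))]
  obtain ⟨F, hF1, hF2, hF3⟩ := exists_extension_of_homotopy (C := C) (fun s z => u (q s z))
    (hu.comp hqc (fun x hx => hqs x.1 hx.1 x.2 hx.2)) (fun s hs z hz => huC (hqs s hs z hz))
    G hGc.continuousOn (fun z _ => Subtype.coe_prop _) hG1
  refine ⟨F, hF1, hF2, fun z hz => (hF3 hz).trans ?_⟩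
  simp only [hq0 z hz]

theorem subsingleton_homotopyGroup {Y : Type} [TopologicalSpace Y] {C : Set Y} {d : ℕ}
    (h : SphereExt C (d + 1)) (x : C) : Subsingleton (HomotopyGroup (Fin d) C x) := by
  suffices key : ∀ f g : GenLoop (Fin d) C x, GenLoop.Homotopic f g by
    refine ⟨fun a b => ?_⟩
    refine Quotient.inductionOn₂ a b (fun f g => ?_)
    exact Quotient.sound (key f g)
  intro f g
  set u : (Fin (d + 1) → ℝ) → Y := fun z =>
    if 0 ≤ z 0 then (g (fun i => toUnit (z i.succ)) : C) else (f (fun i => toUnit (z i.succ)) : C)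
    with hu
  have hcg : ∀ f : GenLoop (Fin d) C x,
      Continuous fun z : Fin (d + 1) → ℝ => ((f (fun i => toUnit (z i.succ)) : C) : Y) := by
    intro f
    refine continuous_subtype_val.comp (f.1.continuous.comp (continuous_pi fun i => ?_))
    exact continuous_toUnit.comp (by fun_prop)
  have hside : ∀ z : Fin (d + 1) → ℝ, ‖fun i : Fin d => z i.succ‖ = 1 → u z = x := by
    intro z hz
    have hb := toUnit_mem_boundary hz
    simp only [hu, GenLoop.boundary g _ hb, GenLoop.boundary f _ hb, ite_self]
  have huc : ContinuousOn u (sphere 0 1) := by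
    refine ContinuousOn.if ?_ (hcg g).continuousOn (hcg f).continuousOn
    rintro z ⟨hz, hf⟩
    have h0 : 0 = z 0 :=
      frontier_le_subset_eq (f := fun _ : Fin (d + 1) → ℝ => (0 : ℝ)) (g := fun z => z 0)
        continuous_const (by fun_prop) hf
    have hz1 : ‖z‖ = 1 := by simpa using hz
    rcases sphere_cases hz1 with h1 | h1 | h1
    · linarith
    · linarith
    · have hb := toUnit_mem_boundary h1
      rw [GenLoop.boundary g _ hb, GenLoop.boundary f _ hb]
  obtain ⟨F, hFc, hFC, hFu⟩ := h u huc (fun z _ => by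
    simp only [hu]; split_ifs <;> exact Subtype.coe_prop _)
  set bx : unitInterval × (Fin d → unitInterval) → (Fin (d + 1) → ℝ) :=
    fun p => Fin.cons (2 * (p.1 : ℝ) - 1) (fun i => 2 * (p.2 i : ℝ) - 1) with hbx
  have hbxc : Continuous bx := by
    refine continuous_pi (fun i => ?_)
    refine Fin.cases ?_ (fun j => ?_) i
    · simp only [hbx, Fin.cons_zero]; fun_prop
    · simp only [hbx, Fin.cons_succ]; fun_prop
  have habs : ∀ s : unitInterval, |2 * (s : ℝ) - 1| ≤ 1 := by
    intro s
    rw [abs_le]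
    constructor <;> linarith [s.2.1, s.2.2]
  have hbxn : ∀ p, ‖bx p‖ = max |2 * (p.1 : ℝ) - 1| ‖fun i => 2 * (p.2 i : ℝ) - 1‖ := by
    intro p
    rw [norm_eq_max_tail]
    simp [hbx]
  have hbxB : ∀ p, bx p ∈ closedBall (0 : Fin (d + 1) → ℝ) 1 := by
    intro p
    rw [mem_closedBall_zero_iff, hbxn]
    exact max_le (habs p.1) (norm_two_mul_sub_le p.2)
  have hbxS : ∀ p, (p.1 = 0 ∨ p.1 = 1 ∨ p.2 ∈ Cube.boundary (Fin d)) →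
      bx p ∈ sphere (0 : Fin (d + 1) → ℝ) 1 := by
    intro p hp
    rw [mem_sphere_zero_iff_norm]
    apply le_antisymm (by simpa using hbxB p)
    rw [hbxn]
    rcases hp with hp | hp | hp
    · simp [hp]
    · rw [hp]; apply le_max_of_le_left; norm_num
    · rw [norm_two_mul_sub_of_mem_boundary hp]; exact le_max_right _ _
  have htail : ∀ p : unitInterval × (Fin d → unitInterval),
      (fun i : Fin d => toUnit (bx p i.succ)) = p.2 := by
    intro p
    ext i
    simp [hbx, toUnit_two_mul_sub]
  refine ⟨⟨⟨⟨fun p => ⟨F (bx p), hFC (hbxB p)⟩, ?_⟩, ?_, ?_⟩, ?_⟩⟩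
  · exact Continuous.subtype_mk (hFc.comp_continuous hbxc hbxB) _
  · intro y
    apply Subtype.ext
    change F (bx (0, y)) = (f y : C)
    rw [hFu (hbxS _ (Or.inl rfl))]
    have h0 : ¬ (0 ≤ bx (0, y) 0) := by simp [hbx]
    simp only [hu, h0, if_false, htail]
  · intro y
    apply Subtype.ext
    change F (bx (1, y)) = (g y : C)
    rw [hFu (hbxS _ (Or.inr (Or.inl rfl)))]
    have h0 : (0 ≤ bx (1, y) 0) := by simp [hbx]
    simp only [hu, h0, if_true, htail]
  · intro t y hy
    apply Subtype.ext
    change F (bx (t, y)) = (f y : C)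
    rw [hFu (hbxS _ (Or.inr (Or.inr hy))), GenLoop.boundary f y hy]
    apply hside
    simpa [hbx] using norm_two_mul_sub_of_mem_boundary hy

theorem IsConn.sphereExt {Y : Type} [TopologicalSpace Y] {C : Set Y} {n : ℤ} (h : IsConn C n)
    {d : ℕ} (hd : (d : ℤ) ≤ n + 1) : SphereExt C d := by
  cases d with
  | zero =>
    obtain ⟨c⟩ := h.1 (by push_cast at hd; omega)
    exact sphereExt_zero ⟨c, c.2⟩
  | succ d => exact sphereExt_succ (h.2 d (by push_cast at hd; omega))

theorem isConn_of_sphereExt {Y : Type} [TopologicalSpace Y] {C : Set Y} {n : ℤ}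
    (h : ∀ d : ℕ, (d : ℤ) ≤ n + 1 → SphereExt C d) (hY : Nonempty Y) : IsConn C n := by
  refine ⟨fun hn => ?_, fun i hi => subsingleton_homotopyGroup (h (i + 1) (by push_cast; omega))⟩
  obtain ⟨F, _, hF, _⟩ := h 0 (by push_cast; omega) (fun _ => hY.some) 
    (by rw [sphere_fin_zero]; exact continuousOn_empty _)
    (by rw [sphere_fin_zero]; exact mapsTo_empty _ _)
  exact ⟨⟨F 0, hF (by simp)⟩⟩

/-- The smallest closed face of the unit cubical grid which contains `x`. -/
def gridCell {m : ℕ} (x : Fin m → ℝ) : Set (Fin m → ℝ) :=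
  {y | ∀ i, (⌊x i⌋ : ℝ) ≤ y i ∧ y i ≤ ⌈x i⌉}

/-- The dimension of the smallest closed face of the unit cubical grid which contains `x`. -/
noncomputable def gridDim {m : ℕ} (x : Fin m → ℝ) : ℕ :=
  (Finset.univ.filter (fun i => ⌊x i⌋ < ⌈x i⌉)).card

theorem self_mem_gridCell {m : ℕ} (x : Fin m → ℝ) : x ∈ gridCell x :=
  fun _ => ⟨Int.floor_le _, Int.le_ceil _⟩

theorem floor_le_of_mem_gridCell {m : ℕ} {x y : Fin m → ℝ} (h : y ∈ gridCell x) (i : Fin m) :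
    ⌊x i⌋ ≤ ⌊y i⌋ := Int.le_floor.2 (h i).1

theorem ceil_le_of_mem_gridCell {m : ℕ} {x y : Fin m → ℝ} (h : y ∈ gridCell x) (i : Fin m) :
    ⌈y i⌉ ≤ ⌈x i⌉ := Int.ceil_le.2 (h i).2

theorem gridCell_subset {m : ℕ} {x y : Fin m → ℝ} (h : y ∈ gridCell x) :
    gridCell y ⊆ gridCell x := by
  intro z hz i
  have h1 : (⌊x i⌋ : ℝ) ≤ ⌊y i⌋ := by exact_mod_cast floor_le_of_mem_gridCell h i
  have h2 : (⌈y i⌉ : ℝ) ≤ ⌈x i⌉ := by exact_mod_cast ceil_le_of_mem_gridCell h i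
  exact ⟨h1.trans (hz i).1, (hz i).2.trans h2⟩

theorem isClosed_gridCell {m : ℕ} (x : Fin m → ℝ) : IsClosed (gridCell x) := by
  have : gridCell x = ⋂ i, {y : Fin m → ℝ | (⌊x i⌋ : ℝ) ≤ y i ∧ y i ≤ ⌈x i⌉} := by
    ext y; simp [gridCell]
  rw [this]
  refine isClosed_iInter (fun i => ?_)
  exact (isClosed_le continuous_const (continuous_apply i)).inter
    (isClosed_le (continuous_apply i) continuous_const)

theorem gridDim_lt_or_eq {m : ℕ} {x y : Fin m → ℝ} (h : y ∈ gridCell x) :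
    gridDim y < gridDim x ∨ ∀ i, ⌊y i⌋ = ⌊x i⌋ ∧ ⌈y i⌉ = ⌈x i⌉ := by
  have hsub : Finset.univ.filter (fun i => ⌊y i⌋ < ⌈y i⌉) ⊆
      Finset.univ.filter (fun i => ⌊x i⌋ < ⌈x i⌉) := by
    intro i hi
    simp only [Finset.mem_filter, Finset.mem_univ, true_and] at hi ⊢
    have := floor_le_of_mem_gridCell h i
    have := ceil_le_of_mem_gridCell h i
    omega
  rcases eq_or_lt_of_le hsub with he | hss
  · right
    intro i
    have h1 := floor_le_of_mem_gridCell h i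
    have h2 := ceil_le_of_mem_gridCell h i
    have h3 := Int.ceil_le_floor_add_one (x i)
    have h4 := Int.floor_le_ceil (y i)
    have h5 : ⌊y i⌋ < ⌈y i⌉ ↔ ⌊x i⌋ < ⌈x i⌉ := by
      simpa using congrArg (fun s => i ∈ s) he
    omega
  · exact Or.inl (Finset.card_lt_card hss)

theorem gridDim_le_of_mem {m : ℕ} {x y : Fin m → ℝ} (h : y ∈ gridCell x) :
    gridDim y ≤ gridDim x := by
  rcases gridDim_lt_or_eq h with h | h
  · exact h.le
  · simp only [gridDim, (h _).1, (h _).2, le_refl]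

theorem gridCell_congr {m : ℕ} {x y : Fin m → ℝ} (h : ∀ i, ⌊y i⌋ = ⌊x i⌋ ∧ ⌈y i⌉ = ⌈x i⌉) :
    gridCell y = gridCell x := by
  simp only [gridCell, (h _).1, (h _).2]

theorem gridDim_congr {m : ℕ} {x y : Fin m → ℝ} (h : ∀ i, ⌊y i⌋ = ⌊x i⌋ ∧ ⌈y i⌉ = ⌈x i⌉) :
    gridDim y = gridDim x := by
  simp only [gridDim, (h _).1, (h _).2]

theorem continuousOn_of_gridCell {m : ℕ} {Y : Type} [TopologicalSpace Y]
    {F : (Fin m → ℝ) → Y} {S : Set (Fin m → ℝ)}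
    (h : ∀ x ∈ S, ContinuousOn F (gridCell x)) : ContinuousOn F S := by
  let I := {p : (Fin m → ℤ) × (Fin m → ℤ) // ∃ x ∈ S, ∀ i, ⌊x i⌋ = p.1 i ∧ ⌈x i⌉ = p.2 i}
  let c : I → Set (Fin m → ℝ) := fun p => gridCell p.2.choose
  have hlf : LocallyFinite c := by
    intro x
    refine ⟨ball x 1, ball_mem_nhds x one_pos, ?_⟩
    have hfin : (Icc (fun i => ⌊x i⌋ - 2) (fun i => ⌊x i⌋ + 2) ×ˢ
      Icc (fun i => ⌊x i⌋ - 2) (fun i => ⌊x i⌋ + 2) :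
        Set ((Fin m → ℤ) × (Fin m → ℤ))).Finite := (finite_Icc _ _).prod (finite_Icc _ _)
    refine (hfin.preimage Subtype.val_injective.injOn).subset ?_
    rintro p ⟨y, hy, hyx⟩
    have key : ∀ i, ⌊x i⌋ - 2 ≤ p.1.1 i ∧ p.1.1 i ≤ ⌊x i⌋ + 2 ∧ ⌊x i⌋ - 2 ≤ p.1.2 i ∧
        p.1.2 i ≤ ⌊x i⌋ + 2 := by
      intro i
      obtain ⟨h1, h2⟩ := p.2.choose_spec.2 i
      have h3 := hy i
      have h6 := Int.ceil_le_floor_add_one (p.2.choose i)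
      have h7 := Int.floor_le_ceil (p.2.choose i)
      rw [h1, h2] at h3 h6 h7
      have h4 : |y i - x i| < 1 := by
        have := (dist_le_pi_dist y x i).trans_lt hyx
        rwa [Real.dist_eq] at this
      rw [abs_lt] at h4
      have h8 := Int.floor_le (x i)
      have h9 := Int.lt_floor_add_one (x i)
      have h10 : p.1.1 i < ⌊x i⌋ + 2 := by
        have : ((p.1.1 i : ℤ) : ℝ) < ((⌊x i⌋ + 2 : ℤ) : ℝ) := by push_cast; linarith
        exact_mod_cast this
      have h11 : ⌊x i⌋ - 1 < p.1.2 i := by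
        have : ((⌊x i⌋ - 1 : ℤ) : ℝ) < ((p.1.2 i : ℤ) : ℝ) := by push_cast; linarith
        exact_mod_cast this
      omega
    exact ⟨⟨fun i => (key i).1, fun i => (key i).2.1⟩,
      ⟨fun i => (key i).2.2.1, fun i => (key i).2.2.2⟩⟩
  refine (hlf.continuousOn_iUnion (fun _ => isClosed_gridCell _)
    (fun p => h _ p.2.choose_spec.1)).mono ?_
  intro x hx
  have hex : ∃ x' ∈ S, ∀ i, ⌊x' i⌋ = ⌊x i⌋ ∧ ⌈x' i⌉ = ⌈x i⌉ := ⟨x, hx, fun _ => ⟨rfl, rfl⟩⟩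
  refine mem_iUnion.2 ⟨⟨(fun i => ⌊x i⌋, fun i => ⌈x i⌉), hex⟩, ?_⟩
  have := gridCell_congr hex.choose_spec.2
  change x ∈ gridCell hex.choose
  rw [this]
  exact self_mem_gridCell x

theorem exists_continuousOn_of_forall_gridCell {m : ℕ} {Y : Type} [TopologicalSpace Y] [Inhabited Y]
    {P : Set (Fin m → ℝ)} (hP : ∀ x ∈ P, gridCell x ⊆ P) (E : (Fin m → ℝ) → Set Y)
    (hE : ∀ x ∈ P, ∀ F : (Fin m → ℝ) → Y,
      ContinuousOn F {y ∈ gridCell x | gridDim y < gridDim x} →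
      (∀ y ∈ gridCell x, gridDim y < gridDim x → F y ∈ E y) →
      ∃ G : (Fin m → ℝ) → Y, ContinuousOn G (gridCell x) ∧
        (∀ y ∈ gridCell x, gridDim y < gridDim x → G y = F y) ∧ ∀ y ∈ gridCell x, G y ∈ E y) :
    ∃ F : (Fin m → ℝ) → Y, ContinuousOn F P ∧ ∀ y ∈ P, F y ∈ E y := by
  classical
  have step : ∀ k : ℕ, ∃ F : (Fin m → ℝ) → Y, ContinuousOn F {y ∈ P | gridDim y < k} ∧
      ∀ y ∈ P, gridDim y < k → F y ∈ E y := by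
    intro k
    induction k with
    | zero => exact ⟨fun _ => default, continuousOn_const, fun y _ h => absurd h (Nat.not_lt_zero _)⟩
    | succ k ih =>
      obtain ⟨F, hFc, hFE⟩ := ih
      have hG : ∀ x : Fin m → ℝ, x ∈ P ∧ gridDim x = k → ∃ G : (Fin m → ℝ) → Y,
          ContinuousOn G (gridCell x) ∧
          (∀ y ∈ gridCell x, gridDim y < gridDim x → G y = F y) ∧
          ∀ y ∈ gridCell x, G y ∈ E y := by
        rintro x ⟨hx, rfl⟩
        exact hE x hx F (hFc.mono fun y hy => ⟨hP x hx hy.1, hy.2⟩)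
          (fun y hy hlt => hFE y (hP x hx hy) hlt)
      choose! G hGc hGF hGE using hG
      let rep0 : (Fin m → ℤ) → (Fin m → ℤ) → (Fin m → ℝ) := fun a b =>
        if h : ∃ p : Fin m → ℝ, ∀ i, ⌊p i⌋ = a i ∧ ⌈p i⌉ = b i then h.choose else 0
      let rep : (Fin m → ℝ) → (Fin m → ℝ) := fun y => rep0 (fun i => ⌊y i⌋) (fun i => ⌈y i⌉)
      have hrep : ∀ y, ∀ i, ⌊rep y i⌋ = ⌊y i⌋ ∧ ⌈rep y i⌉ = ⌈y i⌉ := by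
        intro y
        have h : ∃ p : Fin m → ℝ, ∀ i, ⌊p i⌋ = (fun i => ⌊y i⌋) i ∧ ⌈p i⌉ = (fun i => ⌈y i⌉) i :=
          ⟨y, fun _ => ⟨rfl, rfl⟩⟩
        simp only [rep, rep0, dif_pos h]
        exact h.choose_spec
      have hrepc : ∀ x y : Fin m → ℝ, (∀ i, ⌊y i⌋ = ⌊x i⌋ ∧ ⌈y i⌉ = ⌈x i⌉) → rep y = rep x :=
        fun x y h => congrArg₂ rep0 (funext fun i => (h i).1) (funext fun i => (h i).2)
      have hrepP : ∀ y ∈ P, rep y ∈ P := fun y hy =>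
        hP y hy (gridCell_congr (hrep y) ▸ self_mem_gridCell _)
      refine ⟨fun y => if gridDim y = k then G (rep y) y else F y, ?_, ?_⟩
      · apply continuousOn_of_gridCell
        rintro x ⟨hx, hxk⟩
        by_cases hk : gridDim x = k
        · have hr : rep x ∈ P ∧ gridDim (rep x) = k :=
            ⟨hrepP x hx, (gridDim_congr (hrep x)).trans hk⟩
          have := hGc (rep x) hr
          rw [gridCell_congr (hrep x)] at this
          refine this.congr (fun y hy => ?_)
          rcases gridDim_lt_or_eq hy with hlt | heq
          · have : gridDim y ≠ k := by omega
            simp only [this, if_false]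
            refine (hGF _ hr y ?_ ?_).symm
            · rwa [gridCell_congr (hrep x)]
            · omega
          · simp only [(gridDim_congr heq).trans hk, if_true, hrepc x y heq]
        · have hlt : gridDim x < k := by omega
          refine (hFc.mono fun y hy => ⟨hP x hx hy, ?_⟩).congr (fun y hy => ?_)
          · exact (gridDim_le_of_mem hy).trans_lt hlt
          · have : gridDim y ≠ k := ((gridDim_le_of_mem hy).trans_lt hlt).ne
            simp only [this, if_false]
      · intro y hy hyk
        by_cases hk : gridDim y = k
        · simp only [hk, if_true]
          refine hGE (rep y) ⟨hrepP y hy, (gridDim_congr (hrep y)).trans hk⟩ y ?_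
          rw [gridCell_congr (hrep y)]
          exact self_mem_gridCell y
        · simp only [hk, if_false]
          exact hFE y hy (by omega)
  obtain ⟨F, hFc, hFE⟩ := step (m + 1)
  have hm : ∀ y : Fin m → ℝ, gridDim y < m + 1 := fun y =>
    Nat.lt_succ_of_le ((Finset.card_le_univ _).trans_eq (Fintype.card_fin m))
  exact ⟨F, hFc.mono fun y hy => ⟨hy, hm y⟩, fun y hy => hFE y hy (hm y)⟩

theorem SphereExt.exists_extension_gridCell {m : ℕ} {Y : Type} [TopologicalSpace Y] {C : Set Y}
    {x : Fin m → ℝ} (hC : SphereExt C (gridDim x)) (F : (Fin m → ℝ) → Y)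
    (hF : ContinuousOn F {y ∈ gridCell x | gridDim y < gridDim x})
    (hFC : ∀ y ∈ gridCell x, gridDim y < gridDim x → F y ∈ C) :
    ∃ G : (Fin m → ℝ) → Y, ContinuousOn G (gridCell x) ∧
      (∀ y ∈ gridCell x, gridDim y < gridDim x → G y = F y) ∧ ∀ y ∈ gridCell x, G y ∈ C := by
  classical
  set S := Finset.univ.filter (fun i => ⌊x i⌋ < ⌈x i⌉) with hS
  let e : S ≃ Fin (gridDim x) := S.equivFin
  have hceil : ∀ i ∈ S, ⌈x i⌉ = ⌊x i⌋ + 1 := by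
    intro i hi
    have h1 : ⌊x i⌋ < ⌈x i⌉ := by simpa [hS] using hi
    have h2 := Int.ceil_le_floor_add_one (x i)
    omega
  have hnot : ∀ i ∉ S, ∀ y ∈ gridCell x, y i = x i := by
    intro i hi y hy
    have h1 : ¬ ⌊x i⌋ < ⌈x i⌉ := by simpa [hS] using hi
    have h2 : (⌈x i⌉ : ℝ) ≤ ⌊x i⌋ := by exact_mod_cast not_lt.1 h1
    have h3 := hy i
    have h4 := self_mem_gridCell x i
    linarith [h3.1, h3.2, h4.1, h4.2]
  set φ : (Fin (gridDim x) → ℝ) → (Fin m → ℝ) := fun y i =>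
    if h : i ∈ S then ⌊x i⌋ + (1 + y (e ⟨i, h⟩)) / 2 else x i with hφ
  set ψ : (Fin m → ℝ) → (Fin (gridDim x) → ℝ) := fun z j =>
    2 * (z (e.symm j) - ⌊x (e.symm j)⌋) - 1 with hψ
  have hφc : Continuous φ := by
    refine continuous_pi fun i => ?_
    by_cases h : i ∈ S
    · simp only [hφ, dif_pos h]; fun_prop
    · simp only [hφ, dif_neg h]; fun_prop
  have hψc : Continuous ψ := by simp only [hψ]; fun_prop
  have hφcell : ∀ y : Fin (gridDim x) → ℝ, ‖y‖ ≤ 1 → φ y ∈ gridCell x := by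
    intro y hy i
    by_cases h : i ∈ S
    · have := abs_le.1 ((norm_le_pi_norm y (e ⟨i, h⟩)).trans hy)
      simp only [hφ, dif_pos h, hceil i h]
      push_cast
      constructor <;> linarith [this.1, this.2]
    · simp only [hφ, dif_neg h]
      exact self_mem_gridCell x i
  have hφbd : ∀ y : Fin (gridDim x) → ℝ, ‖y‖ = 1 → gridDim (φ y) < gridDim x := by
    intro y hy
    rcases gridDim_lt_or_eq (hφcell y hy.le) with h | h
    · exact h
    · exfalso
      obtain ⟨j, hj⟩ := exists_abs_eq_one hy
      have hi := (e.symm j).2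
      have h1 := h (e.symm j)
      rw [hceil _ hi] at h1
      have : φ y (e.symm j) = (⌊x (e.symm j)⌋ : ℝ) + (1 + y j) / 2 := by
        simp only [hφ, dif_pos hi, Subtype.coe_eta, Equiv.apply_symm_apply]
      rw [this] at h1
      rcases eq_or_eq_neg_of_abs_eq hj with h2 | h2
      · rw [h2] at h1
        norm_num at h1
      · rw [h2] at h1
        norm_num at h1
  have hφψ : ∀ z ∈ gridCell x, φ (ψ z) = z := by
    intro z hz
    ext i
    by_cases h : i ∈ S
    · simp only [hφ, dif_pos h, hψ, Equiv.symm_apply_apply]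
      ring
    · simp only [hφ, dif_neg h]
      exact (hnot i h z hz).symm
  have hψball : ∀ z ∈ gridCell x, ‖ψ z‖ ≤ 1 := by
    intro z hz
    refine (pi_norm_le_iff_of_nonneg zero_le_one).2 fun j => ?_
    have h1 := hz (e.symm j)
    rw [hceil _ (e.symm j).2] at h1
    push_cast at h1
    rw [Real.norm_eq_abs, abs_le]
    simp only [hψ]
    constructor <;> linarith [h1.1, h1.2]
  have hψsph : ∀ z ∈ gridCell x, gridDim z < gridDim x → ‖ψ z‖ = 1 := by
    intro z hz hlt
    apply le_antisymm (hψball z hz)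
    have : ∃ i ∈ S, ¬ ⌊z i⌋ < ⌈z i⌉ := by
      by_contra! hcon
      refine absurd (Finset.card_le_card (s := S)
        (t := Finset.univ.filter (fun i => ⌊z i⌋ < ⌈z i⌉)) ?_) (not_le.2 hlt)
      intro i hi
      simpa using hcon i hi
    obtain ⟨i, hi, hzi⟩ := this
    refine le_trans ?_ (norm_le_pi_norm (ψ z) (e ⟨i, hi⟩))
    have h1 := floor_le_of_mem_gridCell hz i
    have h2 := ceil_le_of_mem_gridCell hz i
    rw [hceil i hi] at h2
    have h3 : z i = ⌊z i⌋ := by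
      have h4 : (⌈z i⌉ : ℝ) ≤ ⌊z i⌋ := by exact_mod_cast not_lt.1 hzi
      exact le_antisymm ((Int.le_ceil _).trans h4) (Int.floor_le _)
    have h5 := Int.floor_le_ceil (z i)
    simp only [hψ, Equiv.symm_apply_apply, Real.norm_eq_abs]
    have h6 : ⌊z i⌋ = ⌊x i⌋ ∨ ⌊z i⌋ = ⌊x i⌋ + 1 := by omega
    rcases h6 with h6 | h6
    · rw [h3, h6]; norm_num
    · rw [h3, h6]; push_cast; norm_num
  obtain ⟨G, hGc, hGC, hGF⟩ := hC (F ∘ φ)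
    (hF.comp hφc.continuousOn fun y hy => by
      have hy : ‖y‖ = 1 := by simpa using hy
      exact ⟨hφcell y hy.le, hφbd y hy⟩)
    (fun y hy => by
      have hy : ‖y‖ = 1 := by simpa using hy
      exact hFC _ (hφcell y hy.le) (hφbd y hy))
  refine ⟨G ∘ ψ, hGc.comp hψc.continuousOn fun z hz => by simpa using hψball z hz, ?_, ?_⟩
  · intro z hz hlt
    have : ψ z ∈ sphere (0 : Fin (gridDim x) → ℝ) 1 := by simpa using hψsph z hz hlt
    rw [Function.comp_apply, hGF this, Function.comp_apply, hφψ z hz]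
  · intro z hz
    exact hGC (by simpa using hψball z hz)

theorem norm_sub_le_one_of_mem_gridCell {m : ℕ} {x y : Fin m → ℝ} (h : y ∈ gridCell x) :
    ‖y - x‖ ≤ 1 := by
  refine (pi_norm_le_iff_of_nonneg zero_le_one).2 fun i => ?_
  have h1 := h i
  have h2 := self_mem_gridCell x i
  have h3 : (⌈x i⌉ : ℝ) ≤ ⌊x i⌋ + 1 := by exact_mod_cast Int.ceil_le_floor_add_one (x i)
  rw [Pi.sub_apply, Real.norm_eq_abs, abs_le]
  constructor <;> linarith [h1.1, h1.2, h2.1, h2.2]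

theorem abs_le_of_mem_gridCell {m : ℕ} {x y : Fin m → ℝ} (h : y ∈ gridCell x) {N : ℕ} {i : Fin m}
    (hx : |x i| ≤ N) : |y i| ≤ N := by
  rw [abs_le] at hx ⊢
  have h1 : -(N : ℤ) ≤ ⌊x i⌋ := Int.le_floor.2 (by push_cast; exact hx.1)
  have h2 : ⌈x i⌉ ≤ (N : ℤ) := Int.ceil_le.2 (by push_cast; exact hx.2)
  have h1' : -(N : ℝ) ≤ ⌊x i⌋ := by exact_mod_cast h1
  have h2' : (⌈x i⌉ : ℝ) ≤ N := by exact_mod_cast h2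
  exact ⟨h1'.trans (h i).1, (h i).2.trans h2'⟩

theorem norm_le_of_mem_gridCell {m : ℕ} {x y : Fin m → ℝ} (h : y ∈ gridCell x) {N : ℕ}
    (hx : ‖x‖ ≤ N) : ‖y‖ ≤ N :=
  (pi_norm_le_iff_of_nonneg (Nat.cast_nonneg N)).2 fun i =>
    abs_le_of_mem_gridCell h ((norm_le_pi_norm x i).trans hx)

theorem exists_int_coord {m : ℕ} {x : Fin m → ℝ} {N : ℕ} (hN : 0 < N) (hx : ‖x‖ = N) :
    ∃ i, |x i| = N ∧ ⌊x i⌋ = ⌈x i⌉ := by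
  have hN' : (0 : ℝ) < N := by exact_mod_cast hN
  have : ∃ i, |x i| = N := by
    by_contra! hne
    have : ‖x‖ < N := (pi_norm_lt_iff hN').2 fun i =>
      lt_of_le_of_ne (hx ▸ norm_le_pi_norm x i) (hne i)
    linarith
  obtain ⟨i, hi⟩ := this
  refine ⟨i, hi, ?_⟩
  rcases eq_or_eq_neg_of_abs_eq hi with h | h
  · rw [h]; simp
  · rw [h]
    have : -(N : ℝ) = ((-N : ℤ) : ℝ) := by push_cast; rfl
    rw [this, Int.floor_intCast, Int.ceil_intCast]

theorem norm_eq_of_mem_gridCell {m : ℕ} {x y : Fin m → ℝ} (h : y ∈ gridCell x) {N : ℕ}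
    (hN : 0 < N) (hx : ‖x‖ = N) : ‖y‖ = N := by
  apply le_antisymm (norm_le_of_mem_gridCell h hx.le)
  obtain ⟨i, hi, hfc⟩ := exists_int_coord hN hx
  have h1 := h i
  have h2 := self_mem_gridCell x i
  rw [hfc] at h1 h2
  have : y i = x i := by linarith [h1.1, h1.2, h2.1, h2.2]
  rw [← hi, ← this]
  exact norm_le_pi_norm y i

theorem gridDim_lt_of_norm_eq {m : ℕ} {x : Fin m → ℝ} {N : ℕ} (hN : 0 < N) (hx : ‖x‖ = N) :
    gridDim x < m := by
  obtain ⟨i, -, hfc⟩ := exists_int_coord hN hx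
  calc gridDim x < (Finset.univ : Finset (Fin m)).card := by
        apply Finset.card_lt_card
        refine ⟨Finset.filter_subset _ _, fun hsub => ?_⟩
        have := hsub (Finset.mem_univ i)
        simp [hfc] at this
    _ = m := by simp

theorem gridDim_le {m : ℕ} (x : Fin m → ℝ) : gridDim x ≤ m :=
  (Finset.card_le_univ _).trans_eq (Fintype.card_fin m)

section Realization

variable {V : Type}

/-- The closed geometric simplex with vertex set `s`, in barycentric coordinates. -/
def geomSimplex (s : Finset V) : Set (V → ℝ) :=
  {x | (∀ v, 0 ≤ x v) ∧ (∀ v, v ∉ s → x v = 0) ∧ ∑ v ∈ s, x v = 1}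

theorem geomSimplex_mono {s t : Finset V} (h : s ⊆ t) : geomSimplex s ⊆ geomSimplex t := by
  rintro x ⟨h0, hs, h1⟩
  refine ⟨h0, fun v hv => hs v fun hvs => hv (h hvs), ?_⟩
  rw [← h1]
  exact (Finset.sum_subset h fun v _ hv => hs v hv).symm

theorem convex_geomSimplex (s : Finset V) : Convex ℝ (geomSimplex s) := by
  rintro x ⟨hx0, hxs, hx1⟩ y ⟨hy0, hys, hy1⟩ a b ha hb hab
  refine ⟨fun v => ?_, fun v hv => ?_, ?_⟩
  · have := hx0 v
    have := hy0 v
    simp only [Pi.add_apply, Pi.smul_apply, smul_eq_mul]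
    positivity
  · simp [hxs v hv, hys v hv]
  · simp only [Pi.add_apply, Pi.smul_apply, smul_eq_mul, Finset.sum_add_distrib,
      ← Finset.mul_sum, hx1, hy1, mul_one, hab]

theorem geomSimplex_subset_space {K : ASC V} {s : Finset V} (hs : s ∈ K.faces) :
    geomSimplex s ⊆ K.space := fun _ hx => ⟨hx.1, s, hs, hx.2⟩

theorem single_mem_geomSimplex [DecidableEq V] {s : Finset V} {v : V} (hv : v ∈ s) :
    Pi.single v (1 : ℝ) ∈ geomSimplex s := by
  refine ⟨fun w => ?_, fun w hw => ?_, ?_⟩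
  · by_cases h : w = v
    · subst h; simp
    · simp [h]
  · exact Pi.single_eq_of_ne (fun h => hw (by rwa [h])) 1
  · simp [hv]

theorem mem_geomSimplex_filter {s : Finset V} {x : V → ℝ} (hx : x ∈ geomSimplex s) :
    x ∈ geomSimplex (s.filter (fun v => 0 < x v)) := by
  refine ⟨hx.1, fun v hv => ?_, ?_⟩
  · by_cases hvs : v ∈ s
    · exact le_antisymm (not_lt.1 fun h => hv (Finset.mem_filter.2 ⟨hvs, h⟩)) (hx.1 v)
    · exact hx.2.1 v hvs
  · rw [← hx.2.2, Finset.sum_filter_of_ne]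
    exact fun v _ hv => lt_of_le_of_ne (hx.1 v) hv.symm

theorem nonempty_of_mem_geomSimplex {s : Finset V} {x : V → ℝ} (hx : x ∈ geomSimplex s) :
    s.Nonempty := by
  rw [Finset.nonempty_iff_ne_empty]
  rintro rfl
  simpa using hx.2.2

theorem exists_support {K : ASC V} {x : V → ℝ} (hx : x ∈ K.space) :
    ∃ s ∈ K.faces, x ∈ geomSimplex s ∧ ∀ v, v ∈ s ↔ 0 < x v := by
  obtain ⟨h0, s, hs, h⟩ := hx
  have hm := mem_geomSimplex_filter (s := s) (x := x) ⟨h0, h⟩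
  refine ⟨_, K.down_closed hs (Finset.filter_subset _ _) (nonempty_of_mem_geomSimplex hm), hm,
    fun v => ?_⟩
  rw [Finset.mem_filter, and_iff_right_iff_imp]
  intro hv
  by_contra hvs
  exact hv.ne' (h.1 v hvs)

theorem sum_le_one_of_mem_geomSimplex {s : Finset V} {x : V → ℝ}
    (hx : x ∈ geomSimplex s) (t : Finset V) : ∑ v ∈ t, x v ≤ 1 := by
  classical
  have h := (geomSimplex_mono (Finset.subset_union_left (s₂ := t)) hx).2.2
  rw [← h]
  exact Finset.sum_le_sum_of_subset_of_nonneg Finset.subset_union_right fun v _ _ => hx.1 v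

theorem sum_le_one_of_mem_space {K : ASC V} {x : V → ℝ} (hx : x ∈ K.space) (t : Finset V) :
    ∑ v ∈ t, x v ≤ 1 := by
  obtain ⟨s, -, hs, -⟩ := exists_support hx
  exact sum_le_one_of_mem_geomSimplex hs t

/-- A map of a sphere which is homotopic to an extendable map through straight segments is
extendable. -/
theorem exists_extension_of_segment {C : Set (V → ℝ)} {d : ℕ} {u u' : (Fin d → ℝ) → V → ℝ}
    (hu : ContinuousOn u (sphere 0 1)) (hu' : ContinuousOn u' (sphere 0 1))
    (hC : ∀ z ∈ sphere (0 : Fin d → ℝ) 1, segment ℝ (u z) (u' z) ⊆ C)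
    (h : ∃ F : (Fin d → ℝ) → V → ℝ, ContinuousOn F (closedBall 0 1) ∧
      MapsTo F (closedBall 0 1) C ∧ EqOn F u' (sphere 0 1)) :
    ∃ F : (Fin d → ℝ) → V → ℝ, ContinuousOn F (closedBall 0 1) ∧
      MapsTo F (closedBall 0 1) C ∧ EqOn F u (sphere 0 1) := by
  obtain ⟨G, hG, hGC, hGu⟩ := h
  have h1 : ContinuousOn (fun p : ℝ × (Fin d → ℝ) => u p.2) (Icc 0 1 ×ˢ sphere 0 1) :=
    hu.comp continuousOn_snd fun p hp => hp.2
  have h2 : ContinuousOn (fun p : ℝ × (Fin d → ℝ) => u' p.2) (Icc 0 1 ×ˢ sphere 0 1) :=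
    hu'.comp continuousOn_snd fun p hp => hp.2
  obtain ⟨F, hF, hFC, hFu⟩ := exists_extension_of_homotopy (C := C)
    (fun s z => (1 - s) • u z + s • u' z)
    (((continuousOn_const.sub continuousOn_fst).smul h1).add (continuousOn_fst.smul h2))
    (fun s hs z hz => hC z hz ⟨1 - s, s, by linarith [hs.2], hs.1, by ring, rfl⟩)
    G hG hGC (fun z hz => by simpa using hGu hz)
  exact ⟨F, hF, hFC, fun z hz => by simpa using hFu hz⟩

/-- The least barycentric coordinate of `x` on the simplex of `S` contained in the support
of `x`, and `0` if there is no such simplex. -/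
noncomputable def labelMin (S : Set (Finset V)) (x : V → ℝ) : ℝ :=
  open Classical in
  if h : ∃ σ ∈ S, σ.Nonempty ∧ ∀ v ∈ σ, 0 < x v then
    h.choose.inf' h.choose_spec.2.1 x else 0

/-- A face of `X` contains at most one simplex of `S`. -/
def UniqueLabel (X : ASC V) (S : Set (Finset V)) : Prop :=
  (∀ σ ∈ S, σ.Nonempty) ∧ ∀ s ∈ X.faces, ∀ σ ∈ S, ∀ τ ∈ S, σ ⊆ s → τ ⊆ s → σ = τ

theorem UniqueLabel.eq {X : ASC V} {S : Set (Finset V)} (hS : UniqueLabel X S) {x : V → ℝ}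
    (hx : x ∈ X.space) {σ τ : Finset V} (hσ : σ ∈ S) (hτ : τ ∈ S) (hσx : ∀ v ∈ σ, 0 < x v)
    (hτx : ∀ v ∈ τ, 0 < x v) : σ = τ := by
  obtain ⟨s, hs, -, hsx⟩ := exists_support hx
  exact hS.2 s hs σ hσ τ hτ (fun v hv => (hsx v).2 (hσx v hv)) (fun v hv => (hsx v).2 (hτx v hv))

theorem UniqueLabel.mono {X : ASC V} {S T : Set (Finset V)} (hS : UniqueLabel X S)
    (h : T ⊆ S) : UniqueLabel X T :=
  ⟨fun σ hσ => hS.1 σ (h hσ), fun s hs σ hσ τ hτ => hS.2 s hs σ (h hσ) τ (h hτ)⟩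

theorem labelMin_eq {X : ASC V} {S : Set (Finset V)} (hS : UniqueLabel X S) {x : V → ℝ}
    (hx : x ∈ X.space) {σ : Finset V} (hσ : σ ∈ S) (hσx : ∀ v ∈ σ, 0 < x v) :
    labelMin S x = σ.inf' (hS.1 σ hσ) x := by
  have h : ∃ σ ∈ S, σ.Nonempty ∧ ∀ v ∈ σ, 0 < x v := ⟨σ, hσ, hS.1 σ hσ, hσx⟩
  rw [labelMin, dif_pos h]
  have := hS.eq hx h.choose_spec.1 hσ h.choose_spec.2.2 hσx
  congr 1

theorem labelMin_eq_zero {S : Set (Finset V)} {x : V → ℝ}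
    (h : ∀ σ ∈ S, ¬ ∀ v ∈ σ, 0 < x v) : labelMin S x = 0 := by
  rw [labelMin, dif_neg]
  rintro ⟨σ, hσ, -, hσx⟩
  exact h σ hσ hσx

theorem labelMin_nonneg (S : Set (Finset V)) (x : V → ℝ) : 0 ≤ labelMin S x := by
  rw [labelMin]
  split_ifs with h
  · exact Finset.le_inf' _ _ fun v hv => (h.choose_spec.2.2 v hv).le
  · exact le_rfl

theorem exists_label_of_labelMin_pos {S : Set (Finset V)} {x : V → ℝ} (h : 0 < labelMin S x) :
    ∃ σ ∈ S, ∀ v ∈ σ, 0 < x v := by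
  by_contra! hne
  refine h.ne' (labelMin_eq_zero fun σ hσ hpos => ?_)
  obtain ⟨v, hv, hvx⟩ := hne σ hσ
  exact hvx.not_gt (hpos v hv)

theorem continuousOn_labelMin {X : ASC V} {S T : Set (Finset V)} (hS : UniqueLabel X S)
    (hT : T ⊆ S) : ContinuousOn (labelMin T) X.space := by
  classical
  intro x hx
  by_cases hl : ∃ σ ∈ S, ∀ v ∈ σ, 0 < x v
  · obtain ⟨σ, hσ, hσx⟩ := hl
    have hev : ∀ᶠ y in 𝓝[X.space] x, y ∈ X.space ∧ ∀ v ∈ σ, 0 < y v := by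
      refine eventually_mem_nhdsWithin.and (nhdsWithin_le_nhds ?_)
      refine (Finset.eventually_all σ).2 ?_
      exact fun v hv => (continuous_apply v).continuousAt.eventually (lt_mem_nhds (hσx v hv))
    by_cases hσT : σ ∈ T
    · have hc : ContinuousWithinAt (fun y : V → ℝ => σ.inf' (hS.1 σ hσ) y) X.space x :=
        (Continuous.finset_inf'_apply (hS.1 σ hσ)
          (fun v _ => continuous_apply v)).continuousWithinAt
      refine hc.congr_of_eventuallyEq (hev.mono fun y hy => ?_) ?_
      · exact labelMin_eq (hS.mono hT) hy.1 hσT hy.2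
      · exact labelMin_eq (hS.mono hT) hx hσT hσx
    · have hz : ∀ y ∈ X.space, (∀ v ∈ σ, 0 < y v) → labelMin T y = 0 := fun y hy hσy =>
        labelMin_eq_zero fun τ hτ hτy => hσT (hS.eq hy hσ (hT hτ) hσy hτy ▸ hτ)
      exact (continuousWithinAt_const (b := (0 : ℝ))).congr_of_eventuallyEq
        (hev.mono fun y hy => hz y hy.1 hy.2) (hz x hx hσx)
  · push Not at hl
    obtain ⟨s, hs, hxs, hsx⟩ := exists_support hx
    have hx0 : labelMin T x = 0 := labelMin_eq_zero fun τ hτ hτx => by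
      obtain ⟨v, hv, hvx⟩ := hl τ (hT hτ)
      exact hvx.not_gt (hτx v hv)
    rw [ContinuousWithinAt, hx0]
    have hlim : Filter.Tendsto (fun y : V → ℝ => 1 - ∑ v ∈ s, y v) (𝓝[X.space] x) (𝓝 0) := by
      have : Continuous (fun y : V → ℝ => 1 - ∑ v ∈ s, y v) := by fun_prop
      have h := (this.continuousWithinAt (s := X.space) (x := x)).tendsto
      rwa [hxs.2.2, sub_self] at h
    refine tendsto_of_tendsto_of_tendsto_of_le_of_le' tendsto_const_nhds hlim
      (Filter.Eventually.of_forall fun y => labelMin_nonneg T y) ?_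
    filter_upwards [self_mem_nhdsWithin] with y hy
    by_cases hly : ∃ σ ∈ T, ∀ v ∈ σ, 0 < y v
    · obtain ⟨σ, hσ, hσy⟩ := hly
      rw [labelMin_eq (hS.mono hT) hy hσ hσy]
      obtain ⟨v, hv, hvx⟩ := hl σ (hT hσ)
      have hvs : v ∉ s := fun h => hvx.not_gt ((hsx v).1 h)
      have h1 := sum_le_one_of_mem_space hy (insert v s)
      rw [Finset.sum_insert hvs] at h1
      linarith [Finset.inf'_le (f := y) hv]
    · rw [labelMin_eq_zero (fun σ hσ h => hly ⟨σ, hσ, h⟩)]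
      linarith [sum_le_one_of_mem_space hy s]

/-- Radial projection away from the simplices of `S`, which all have `k` vertices. -/
noncomputable def unlabel (S : Set (Finset V)) (k : ℕ) (x : V → ℝ) : V → ℝ :=
  fun v => (x v - labelMin {σ ∈ S | v ∈ σ} x) / (1 - k * labelMin S x)

theorem continuousOn_unlabel {X : ASC V} {S : Set (Finset V)} (hS : UniqueLabel X S) (k : ℕ) :
    ContinuousOn (unlabel S k) {x ∈ X.space | k * labelMin S x < 1} := by
  refine continuousOn_pi.2 fun v => ?_
  have h1 := (continuousOn_labelMin hS (Subset.refl S)).mono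
    (sep_subset X.space fun x => k * labelMin S x < 1)
  have h2 := (continuousOn_labelMin hS (sep_subset S fun σ => v ∈ σ)).mono
    (sep_subset X.space fun x => k * labelMin S x < 1)
  exact ((continuous_apply v).continuousOn.sub h2).div
    (continuousOn_const.sub (continuousOn_const.mul h1)) fun x hx => (sub_pos.2 hx.2).ne'

theorem unlabel_eq_self {S : Set (Finset V)} {x : V → ℝ} (k : ℕ)
    (h : ∀ σ ∈ S, ¬ ∀ v ∈ σ, 0 < x v) : unlabel S k x = x := by
  ext v
  rw [unlabel, labelMin_eq_zero h, labelMin_eq_zero fun σ hσ => h σ hσ.1]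
  simp

theorem exists_unlabel_mem {X : ASC V} {S : Set (Finset V)} (hS : UniqueLabel X S) {k : ℕ}
    (hk : ∀ σ ∈ S, σ.card = k) {s σ : Finset V} (hs : s ∈ X.faces) {x : V → ℝ}
    (hxs : x ∈ geomSimplex s) (hx1 : k * labelMin S x < 1) (hσ : σ ∈ S)
    (hσx : ∀ v ∈ σ, 0 < x v) :
    ∃ t ⊆ s, ¬ σ ⊆ t ∧ unlabel S k x ∈ geomSimplex t := by
  classical
  have hx := geomSimplex_subset_space hs hxs
  have hσs : σ ⊆ s := fun v hv => by
    by_contra h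
    exact (hσx v hv).ne' (hxs.2.1 v h)
  have hm := labelMin_eq hS hx hσ hσx
  set m := σ.inf' (hS.1 σ hσ) x with hmdef
  have hv : ∀ v, unlabel S k x v = (x v - if v ∈ σ then m else 0) / (1 - k * m) := by
    intro v
    rw [unlabel, hm]
    congr 2
    split_ifs with hvσ
    · exact labelMin_eq (hS.mono (sep_subset _ _)) hx ⟨hσ, hvσ⟩ hσx
    · exact labelMin_eq_zero fun τ hτ hτx => hvσ (hS.eq hx hσ hτ.1 hσx hτx ▸ hτ.2)
  rw [hm] at hx1
  have hmem : unlabel S k x ∈ geomSimplex s := by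
    refine ⟨fun v => ?_, fun v hvs => ?_, ?_⟩
    · rw [hv]
      refine div_nonneg ?_ (sub_pos.2 hx1).le
      split_ifs with hvσ
      · exact sub_nonneg.2 (Finset.inf'_le _ hvσ)
      · simpa using hxs.1 v
    · rw [hv, if_neg fun h => hvs (hσs h), hxs.2.1 v hvs]
      simp
    · simp only [hv]
      rw [← Finset.sum_div, Finset.sum_sub_distrib, hxs.2.2, Finset.sum_ite_mem,
        Finset.inter_eq_right.2 hσs, Finset.sum_const, hk σ hσ, nsmul_eq_mul]
      exact div_self (sub_pos.2 hx1).ne'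
  refine ⟨_, Finset.filter_subset _ _, fun hsub => ?_, mem_geomSimplex_filter hmem⟩
  obtain ⟨v, hvσ, hvm⟩ := Finset.exists_mem_eq_inf' (hS.1 σ hσ) x
  have h := (Finset.mem_filter.1 (hsub hvσ)).2
  rw [hv, if_pos hvσ, hmdef, hvm, sub_self, zero_div] at h
  exact lt_irrefl _ h

theorem ASC.space_mono {K L : ASC V} (h : K.faces ⊆ L.faces) : K.space ⊆ L.space :=
  fun _ hx => ⟨hx.1, hx.2.choose, h hx.2.choose_spec.1, hx.2.choose_spec.2⟩

theorem labelMin_vertex {x : V → ℝ} {v : V} (hx : 0 ≤ x v) : labelMin {{v}} x = x v := by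
  rcases hx.lt_or_eq with h | h
  · have hex : ∃ σ ∈ ({{v}} : Set (Finset V)), σ.Nonempty ∧ ∀ w ∈ σ, 0 < x w :=
      ⟨{v}, rfl, Finset.singleton_nonempty v, by simpa using h⟩
    rw [labelMin, dif_pos hex]
    have hinf : ∀ (σ : Finset V) (h : σ.Nonempty), σ = {v} → σ.inf' h x = x v := by
      rintro _ _ rfl
      exact Finset.inf'_singleton x
    exact hinf _ _ hex.choose_spec.1
  · rw [← h]
    exact labelMin_eq_zero fun σ hσ hpos => by
      rw [mem_singleton_iff] at hσ
      subst hσ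
      have := hpos v (Finset.mem_singleton_self v)
      linarith

theorem exists_finset_sum_pos {K : ASC V} {A : Type} [TopologicalSpace A] {P : Set A}
    (hP : IsCompact P) {g : A → V → ℝ} (hg : ContinuousOn g P) (hgK : MapsTo g P K.space) :
    ∃ T : Finset V, ∀ z ∈ P, 0 < ∑ v ∈ T, g z v := by
  classical
  suffices h : ∃ T : Finset V, ∀ z ∈ P, z ∈ P → 0 < ∑ v ∈ T, g z v by
    obtain ⟨T, hT⟩ := h
    exact ⟨T, fun z hz => hT z hz hz⟩
  refine hP.induction_on (p := fun Q => ∃ T : Finset V, ∀ z ∈ Q, z ∈ P → 0 < ∑ v ∈ T, g z v)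
    ⟨∅, fun z hz => absurd hz (notMem_empty z)⟩
    (fun Q R hQR ⟨T, hT⟩ => ⟨T, fun z hz => hT z (hQR hz)⟩) ?_ ?_
  · rintro Q R ⟨T, hT⟩ ⟨T', hT'⟩
    refine ⟨T ∪ T', fun z hz hzP => ?_⟩
    have h0 : ∀ v, 0 ≤ g z v := (hgK hzP).1
    rcases hz with hz | hz
    · exact (hT z hz hzP).trans_le (Finset.sum_le_sum_of_subset_of_nonneg
        Finset.subset_union_left fun v _ _ => h0 v)
    · exact (hT' z hz hzP).trans_le (Finset.sum_le_sum_of_subset_of_nonneg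
        Finset.subset_union_right fun v _ _ => h0 v)
  · intro z hz
    obtain ⟨s, -, hzs, -⟩ := exists_support (hgK hz)
    have hc : Continuous fun x : V → ℝ => ∑ v ∈ s, x v := by fun_prop
    have hcz : ContinuousWithinAt (fun y => ∑ v ∈ s, g y v) P z :=
      (hc.comp_continuousOn hg) z hz
    have hpos : (0 : ℝ) < ∑ v ∈ s, g z v := by rw [hzs.2.2]; exact one_pos
    exact ⟨_, hcz.eventually (lt_mem_nhds hpos), s, fun y hy _ => hy⟩

end Realization

section Compression

variable {V : Type}

theorem exists_isOpen_forall_mem_iff {A B : Type} [TopologicalSpace A] [TopologicalSpace B] {f : A → B}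
    {P : Set A} (hf : ContinuousOn f P) {t : Set B} (ht : IsOpen t) :
    ∃ u : Set A, IsOpen u ∧ ∀ z ∈ P, z ∈ u ↔ f z ∈ t := by
  obtain ⟨u, hu, h⟩ := continuousOn_iff'.1 hf t ht
  refine ⟨u, hu, fun z hz => ?_⟩
  have := congrArg (fun s => z ∈ s) h
  simpa [hz] using this.symm

theorem labelMin_singleton {X : ASC V} {S : Set (Finset V)} (hS : UniqueLabel X S) {x : V → ℝ}
    (hx : x ∈ X.space) {σ : Finset V} (hσ : σ ∈ S) (hσx : ∀ v ∈ σ, 0 < x v) :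
    labelMin {σ} x = labelMin S x := by
  rw [labelMin_eq hS hx hσ hσx, labelMin_eq (hS.mono (singleton_subset_iff.2 hσ)) hx rfl hσx]

/-- If every simplex of `S` can be avoided inside a sufficiently connected complex `C σ`, then a
map into `X` can be replaced by a map into the subcomplex `Z` of unlabelled simplices. -/
theorem exists_compression [DecidableEq V] {X Z : ASC V} {S : Set (Finset V)} {k : ℕ}
    (hS : UniqueLabel X S) (hk : ∀ σ ∈ S, σ.card = k) (C : Finset V → ASC V)
    (hZ : ∀ s ∈ X.faces, (∀ σ ∈ S, ¬ σ ⊆ s) → s ∈ Z.faces)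
    (hC : ∀ σ ∈ S, ∀ s : Finset V, s.Nonempty → s ∪ σ ∈ X.faces → ¬ σ ⊆ s → s ∈ (C σ).faces)
    (hCZ : ∀ σ ∈ S, (C σ).faces ⊆ Z.faces)
    {m e : ℕ} {P : Set (Fin m → ℝ)} (hP : IsCompact P)
    (hgrid : ∀ N : ℕ, 0 < N → ∀ x : Fin m → ℝ, (N : ℝ)⁻¹ • x ∈ P →
      gridDim x ≤ e ∧ ∀ y ∈ gridCell x, (N : ℝ)⁻¹ • y ∈ P)
    (hext : ∀ σ ∈ S, ∀ d ≤ e, SphereExt (C σ).space d)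
    {g : (Fin m → ℝ) → V → ℝ} (hg : ContinuousOn g P) (hgX : MapsTo g P X.space) :
    ∃ F : (Fin m → ℝ) → V → ℝ, ContinuousOn F P ∧ MapsTo F P Z.space ∧
      (∀ z ∈ P, k * labelMin S (g z) ≤ 1 / 2 → F z = unlabel S k (g z)) ∧
      ∀ z ∈ P, ∀ σ ∈ S, (∀ v ∈ σ, 0 < g z v) → F z ∈ (C σ).space := by
  have hfc : ∀ T ⊆ S, ContinuousOn (fun z => k * labelMin T (g z)) P := fun T hT =>
    continuousOn_const.mul ((continuousOn_labelMin hS hT).comp hg hgX)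
  obtain ⟨U, hUo, hU⟩ := exists_isOpen_forall_mem_iff (hfc S Subset.rfl) (isOpen_Iio (a := (1 : ℝ)))
  choose W hWo hW using fun σ : S =>
    exists_isOpen_forall_mem_iff (hfc {σ.1} (singleton_subset_iff.2 σ.2)) (isOpen_Ioi (a := (1 / 2 : ℝ)))
  have hlabel : ∀ z, ∀ σ ∈ S, 1 / 2 < k * labelMin {σ} (g z) → ∀ v ∈ σ, 0 < g z v := by
    intro z σ _ hz
    have hpos : 0 < labelMin {σ} (g z) := by
      by_contra h
      have := le_antisymm (not_lt.1 h) (labelMin_nonneg _ _)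
      rw [this] at hz
      norm_num at hz
    obtain ⟨τ, hτ, h⟩ := exists_label_of_labelMin_pos hpos
    rwa [mem_singleton_iff.1 hτ] at h
  obtain ⟨δ, hδ, hδc⟩ := lebesgue_number_lemma_of_metric (c := fun i : Option S => i.elim U W) hP
    (fun i => by cases i; exacts [hUo, hWo _]) (fun z hz => by
      rw [mem_iUnion]
      by_cases h : k * labelMin S (g z) < 1
      · exact ⟨none, (hU z hz).2 h⟩
      · have hpos : 0 < labelMin S (g z) := by
          by_contra h0
          have := le_antisymm (not_lt.1 h0) (labelMin_nonneg _ _)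
          rw [this] at h
          norm_num at h
        obtain ⟨σ, hσ, hσz⟩ := exists_label_of_labelMin_pos hpos
        refine ⟨some ⟨σ, hσ⟩, (hW ⟨σ, hσ⟩ z hz).2 ?_⟩
        rw [mem_Ioi, labelMin_singleton hS (hgX hz) hσ hσz]
        linarith)
  obtain ⟨N', hN'⟩ := exists_nat_one_div_lt hδ
  obtain ⟨N, hN, hNδ⟩ : ∃ N : ℕ, 0 < N ∧ (N : ℝ)⁻¹ < δ :=
    ⟨N' + 1, Nat.succ_pos _, by rw [← one_div]; exact_mod_cast hN'⟩
  have hN0 : (0 : ℝ) < N := by exact_mod_cast hN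
  have hcell : ∀ x : Fin m → ℝ, (N : ℝ)⁻¹ • x ∈ P →
      (∀ y ∈ gridCell x, k * labelMin S (g ((N : ℝ)⁻¹ • y)) < 1) ∨
      ∃ σ ∈ S, ∀ y ∈ gridCell x, 1 / 2 < k * labelMin {σ} (g ((N : ℝ)⁻¹ • y)) := by
    intro x hx
    obtain ⟨i, hi⟩ := hδc _ hx
    have hball : ∀ y ∈ gridCell x, (N : ℝ)⁻¹ • y ∈ ball ((N : ℝ)⁻¹ • x) δ := by
      intro y hy
      rw [mem_ball, dist_eq_norm, ← smul_sub, norm_smul, Real.norm_of_nonneg (inv_nonneg.2 hN0.le)]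
      calc (N : ℝ)⁻¹ * ‖y - x‖ ≤ (N : ℝ)⁻¹ * 1 :=
            mul_le_mul_of_nonneg_left (norm_sub_le_one_of_mem_gridCell hy) (inv_nonneg.2 hN0.le)
        _ < δ := by rwa [mul_one]
    cases i with
    | none => exact Or.inl fun y hy => (hU _ ((hgrid N hN x hx).2 y hy)).1 (hi (hball y hy))
    | some σ =>
      exact Or.inr ⟨σ.1, σ.2, fun y hy => (hW σ _ ((hgrid N hN x hx).2 y hy)).1 (hi (hball y hy))⟩
  let E : (Fin m → ℝ) → Set (V → ℝ) := fun x =>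
    {w | w ∈ Z.space ∧ ((∀ y ∈ gridCell x, k * labelMin S (g ((N : ℝ)⁻¹ • y)) < 1) →
        w = unlabel S k (g ((N : ℝ)⁻¹ • x))) ∧
      ∀ σ ∈ S, (∀ v ∈ σ, 0 < g ((N : ℝ)⁻¹ • x) v) → w ∈ (C σ).space}
  have hCspace : ∀ σ ∈ S, (C σ).space ⊆ Z.space := fun σ hσ x hx =>
    ⟨hx.1, hx.2.choose, hCZ σ hσ hx.2.choose_spec.1, hx.2.choose_spec.2⟩
  have hscale : Continuous fun y : Fin m → ℝ => (N : ℝ)⁻¹ • y := by fun_prop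
  obtain ⟨F, hFc, hFE⟩ := exists_continuousOn_of_forall_gridCell
    (P := {x : Fin m → ℝ | (N : ℝ)⁻¹ • x ∈ P})
    (fun x hx y hy => (hgrid N hN x hx).2 y hy) E (by
      intro x hx F hF hFE
      have hxc := (hgrid N hN x hx).2
      by_cases hA : ∀ y ∈ gridCell x, k * labelMin S (g ((N : ℝ)⁻¹ • y)) < 1
      · refine ⟨fun y => unlabel S k (g ((N : ℝ)⁻¹ • y)), ?_, ?_, ?_⟩
        · exact (continuousOn_unlabel hS k).comp
            (hg.comp hscale.continuousOn fun y hy => hxc y hy)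
            fun y hy => ⟨hgX (hxc y hy), hA y hy⟩
        · exact fun y hy hlt => ((hFE y hy hlt).2.1 fun y' hy' => hA y' (gridCell_subset hy hy')).symm
        · intro y hy
          have hyX := hgX (hxc y hy)
          have hlab : ∀ σ ∈ S, (∀ v ∈ σ, 0 < g ((N : ℝ)⁻¹ • y) v) →
              unlabel S k (g ((N : ℝ)⁻¹ • y)) ∈ (C σ).space := by
            intro σ hσ hσy
            obtain ⟨s, hs, hys, hsy⟩ := exists_support hyX
            obtain ⟨t, hts, hσt, ht⟩ := exists_unlabel_mem hS hk hs hys (hA y hy) hσ hσy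
            have htne := nonempty_of_mem_geomSimplex ht
            refine geomSimplex_subset_space (hC σ hσ t htne ?_ hσt) ht
            exact X.down_closed hs (Finset.union_subset hts fun v hv => (hsy v).2 (hσy v hv))
              (htne.mono Finset.subset_union_left)
          refine ⟨?_, fun _ => rfl, hlab⟩
          by_cases h : ∃ σ ∈ S, ∀ v ∈ σ, 0 < g ((N : ℝ)⁻¹ • y) v
          · obtain ⟨σ, hσ, hσy⟩ := h
            exact hCspace σ hσ (hlab σ hσ hσy)
          · have h' : ∀ σ ∈ S, ¬ ∀ v ∈ σ, 0 < g ((N : ℝ)⁻¹ • y) v := fun σ hσ hy => h ⟨σ, hσ, hy⟩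
            obtain ⟨s, hs, hys, hsy⟩ := exists_support hyX
            change unlabel S k (g ((N : ℝ)⁻¹ • y)) ∈ Z.space
            rw [unlabel_eq_self k h']
            exact geomSimplex_subset_space
              (hZ s hs fun σ hσ hσs => h' σ hσ fun v hv => (hsy v).1 (hσs hv)) hys
      · obtain ⟨σ, hσ, hσx⟩ := (hcell x hx).resolve_left hA
        have hlab : ∀ y ∈ gridCell x, ∀ v ∈ σ, 0 < g ((N : ℝ)⁻¹ • y) v := fun y hy =>
          hlabel _ σ hσ (hσx y hy)
        obtain ⟨G, hGc, hGF, hGC⟩ := (hext σ hσ _ (hgrid N hN x hx).1).exists_extension_gridCell F hF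
          (fun y hy hlt => (hFE y hy hlt).2.2 σ hσ (hlab y hy))
        refine ⟨G, hGc, hGF, fun y hy => ?_⟩
        rcases gridDim_lt_or_eq hy with hlt | heq
        · rw [hGF y hy hlt]
          exact hFE y hy hlt
        · refine ⟨hCspace σ hσ (hGC y hy), fun h => ?_, fun τ hτ hτy => ?_⟩
          · rw [gridCell_congr heq] at h
            exact absurd h hA
          · rw [← hS.eq (hgX (hxc y hy)) hσ hτ (hlab y hy) hτy]
            exact hGC y hy)
  have hinv : ∀ z : Fin m → ℝ, (N : ℝ)⁻¹ • (N : ℝ) • z = z := fun z => inv_smul_smul₀ hN0.ne' z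
  have hmem : ∀ z ∈ P, (N : ℝ) • z ∈ {x : Fin m → ℝ | (N : ℝ)⁻¹ • x ∈ P} := fun z hz => by
    rwa [mem_ofPred_eq, hinv]
  have hF := fun z hz => hFE _ (hmem z hz)
  simp only [E, mem_ofPred_eq, hinv] at hF
  refine ⟨fun z => F ((N : ℝ) • z), hFc.comp (by fun_prop) hmem, fun z hz => (hF z hz).1,
    fun z hz hz2 => ?_, fun z hz => (hF z hz).2.2⟩
  rcases hcell ((N : ℝ) • z) (hmem z hz) with h | ⟨σ, hσ, h⟩
  · exact (hF z hz).2.1 h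
  · have h3 := h _ (self_mem_gridCell _)
    rw [hinv] at h3
    rw [labelMin_singleton hS (hgX hz) hσ (hlabel z σ hσ h3)] at h3
    linarith

theorem gridCell_closedBall {m N : ℕ} (hN : 0 < N) {x : Fin m → ℝ}
    (hx : (N : ℝ)⁻¹ • x ∈ closedBall (0 : Fin m → ℝ) 1) :
    gridDim x ≤ m ∧ ∀ y ∈ gridCell x, (N : ℝ)⁻¹ • y ∈ closedBall (0 : Fin m → ℝ) 1 := by
  have hN0 : (0 : ℝ) < N := by exact_mod_cast hN
  have key : ∀ y : Fin m → ℝ, (N : ℝ)⁻¹ • y ∈ closedBall (0 : Fin m → ℝ) 1 ↔ ‖y‖ ≤ N := by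
    intro y
    rw [mem_closedBall_zero_iff, norm_smul, Real.norm_of_nonneg (inv_nonneg.2 hN0.le),
      inv_mul_le_iff₀ hN0, mul_one]
  exact ⟨gridDim_le x, fun y hy => (key y).2 (norm_le_of_mem_gridCell hy ((key x).1 hx))⟩

theorem gridCell_sphere {m N : ℕ} (hN : 0 < N) {x : Fin m → ℝ}
    (hx : (N : ℝ)⁻¹ • x ∈ sphere (0 : Fin m → ℝ) 1) :
    gridDim x < m ∧ ∀ y ∈ gridCell x, (N : ℝ)⁻¹ • y ∈ sphere (0 : Fin m → ℝ) 1 := by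
  have hN0 : (0 : ℝ) < N := by exact_mod_cast hN
  have key : ∀ y : Fin m → ℝ, (N : ℝ)⁻¹ • y ∈ sphere (0 : Fin m → ℝ) 1 ↔ ‖y‖ = N := by
    intro y
    rw [mem_sphere_zero_iff_norm, norm_smul, Real.norm_of_nonneg (inv_nonneg.2 hN0.le),
      inv_mul_eq_iff_eq_mul₀ hN0.ne', mul_one]
  exact ⟨gridDim_lt_of_norm_eq hN ((key x).1 hx),
    fun y hy => (key y).2 (norm_eq_of_mem_gridCell hy hN ((key x).1 hx))⟩

end Compression

section LinkArgument

variable {V : Type} [DecidableEq V]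

/-- The join of the boundary of the simplex `σ` with the complex `G`. -/
def bdJoin (σ : Finset V) (G : ASC V) : ASC V where
  faces := {s | s.Nonempty ∧ ¬ σ ⊆ s ∧ ((s \ σ).Nonempty → s \ σ ∈ G.faces)}
  nonempty_of_mem := fun _ hs => hs.1
  down_closed := by
    rintro s t ⟨-, h2, h3⟩ hts ht
    have h4 : t \ σ ⊆ s \ σ := Finset.sdiff_subset_sdiff hts Subset.rfl
    exact ⟨ht, fun h => h2 (h.trans hts), fun h => G.down_closed (h3 (h.mono h4)) h4 h⟩

theorem mem_bdJoin {σ : Finset V} {G : ASC V} {s : Finset V} :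
    s ∈ (bdJoin σ G).faces ↔
      s.Nonempty ∧ ¬ σ ⊆ s ∧ ((s \ σ).Nonempty → s \ σ ∈ G.faces) := Iff.rfl

/-- The subcomplex of the faces satisfying a property inherited by subsets. -/
def ASC.restrict (K : ASC V) (p : Finset V → Prop) (hp : ∀ s t, t ⊆ s → p s → p t) : ASC V where
  faces := {s | s ∈ K.faces ∧ p s}
  nonempty_of_mem := fun _ h => K.nonempty_of_mem h.1
  down_closed := fun s t h hts ht => ⟨K.down_closed h.1 hts ht, hp s t hts h.2⟩

theorem sphereExt_bdJoin_singleton {G : ASC V} {v : V} (hdisj : ∀ s ∈ G.faces, Disjoint {v} s)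
    {d : ℕ} (h : SphereExt G.space d) : SphereExt (bdJoin {v} G).space d := by
  have : (bdJoin {v} G).faces = G.faces := by
    ext s
    rw [mem_bdJoin, Finset.singleton_subset_iff]
    constructor
    · rintro ⟨h1, h2, h3⟩
      rw [Finset.sdiff_singleton_eq_erase, Finset.erase_eq_of_notMem h2] at h3
      exact h3 h1
    · intro hs
      have h2 : v ∉ s := Finset.disjoint_singleton_left.1 (hdisj s hs)
      rw [Finset.sdiff_singleton_eq_erase, Finset.erase_eq_of_notMem h2]
      exact ⟨G.nonempty_of_mem hs, h2, fun _ => hs⟩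
  rwa [Subset.antisymm (ASC.space_mono this.subset) (ASC.space_mono this.superset)]

theorem sphereExt_bdJoin_insert {G : ASC V} {v : V} {σ : Finset V} (hvσ : v ∉ σ)
    (hσ : σ.Nonempty) (hdisj : ∀ s ∈ G.faces, Disjoint (insert v σ) s) {d : ℕ}
    (h : ∀ e < d, SphereExt (bdJoin σ G).space e) :
    SphereExt (bdJoin (insert v σ) G).space d := by
  obtain ⟨w, hw⟩ := hσ
  have hvw : v ≠ w := fun h => hvσ (h ▸ hw)
  set X := bdJoin (insert v σ) G with hX
  have hwX : ({w} : Finset V) ∈ X.faces := by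
    refine mem_bdJoin.2 ⟨Finset.singleton_nonempty w, fun hsub => ?_, fun hne => ?_⟩
    · exact hvw (Finset.mem_singleton.1 (hsub (Finset.mem_insert_self v σ)))
    · rw [Finset.sdiff_eq_empty_iff_subset.2 (by simp [hw])] at hne
      exact absurd hne (by simp)
  have hwspace := geomSimplex_subset_space hwX (single_mem_geomSimplex (Finset.mem_singleton_self w))
  rcases Nat.eq_zero_or_pos d with rfl | hd
  · exact sphereExt_zero ⟨_, hwspace⟩
  intro u hu huX
  let Z := X.restrict (fun s => v ∉ s) fun s t hts hs ht => hs (hts ht)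
  have hvJoin : ∀ s ∈ (bdJoin σ G).faces, v ∉ s ∧ s \ insert v σ = s \ σ := by
    intro s hs
    have hvs : v ∉ s := fun hvs => by
      have hv : v ∈ s \ σ := Finset.mem_sdiff.2 ⟨hvs, hvσ⟩
      exact Finset.disjoint_left.1 (hdisj _ ((mem_bdJoin.1 hs).2.2 ⟨v, hv⟩))
        (Finset.mem_insert_self v σ) hv
    exact ⟨hvs, by rw [Finset.sdiff_insert, Finset.erase_eq_of_notMem]; simp [hvs]⟩
  have hlabel : UniqueLabel X {{v}} :=
    ⟨fun σ hσ => by rw [mem_singleton_iff.1 hσ]; exact Finset.singleton_nonempty v,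
      fun _ _ σ hσ τ hτ _ _ => (mem_singleton_iff.1 hσ).trans (mem_singleton_iff.1 hτ).symm⟩
  have hcard : ∀ σ ∈ ({{v}} : Set (Finset V)), σ.card = 1 := fun σ hσ => by
    rw [mem_singleton_iff.1 hσ, Finset.card_singleton]
  obtain ⟨F, hF, hFZ, hF1, hF2⟩ := exists_compression (Z := Z) (e := d - 1) hlabel hcard
    (fun _ => bdJoin σ G)
    (fun s hs hsv => ⟨hs, fun hv => hsv {v} rfl (Finset.singleton_subset_iff.2 hv)⟩)
    (by
      rintro _ rfl s hne hs hvs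
      rw [Finset.singleton_subset_iff] at hvs
      obtain ⟨-, h1, h2⟩ := mem_bdJoin.1 hs
      have h3 : (s ∪ {v}) \ insert v σ = s \ σ := by
        ext a
        simp only [Finset.mem_sdiff, Finset.mem_union, Finset.mem_singleton, Finset.mem_insert]
        constructor
        · rintro ⟨h | h, h'⟩ <;> tauto
        · rintro ⟨h, h'⟩
          refine ⟨Or.inl h, ?_⟩
          rintro (rfl | h'')
          exacts [hvs h, h' h'']
      rw [h3] at h2
      refine mem_bdJoin.2 ⟨hne, fun hσs => h1 ?_, h2⟩
      intro a ha
      rcases Finset.mem_insert.1 ha with rfl | ha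
      · simp
      · exact Finset.mem_union_left _ (hσs ha))
    (by
      rintro _ rfl s hs
      obtain ⟨hvs, heq⟩ := hvJoin s hs
      obtain ⟨h1, -, h3⟩ := mem_bdJoin.1 hs
      refine ⟨mem_bdJoin.2 ⟨h1, fun hsub => hvs (hsub (Finset.mem_insert_self v σ)), ?_⟩, hvs⟩
      rwa [heq])
    (isCompact_sphere (0 : Fin d → ℝ) 1)
    (fun N hN x hx => ⟨Nat.le_sub_one_of_lt (gridCell_sphere hN hx).1, (gridCell_sphere hN hx).2⟩)
    (fun _ _ e he => h e (by omega)) hu huX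
  have hlab : ∀ z ∈ sphere (0 : Fin d → ℝ) 1, labelMin {{v}} (u z) = u z v := fun z hz =>
    labelMin_vertex ((huX hz).1 v)
  set g : (Fin d → ℝ) → V → ℝ := fun z =>
    (1 - min 1 (2 * u z v)) • F z + min 1 (2 * u z v) • Pi.single v (1 : ℝ) with hg
  have huv : ContinuousOn (fun z => u z v) (sphere 0 1) :=
    (continuous_apply v).comp_continuousOn hu
  have hmin : ContinuousOn (fun z => min 1 (2 * u z v)) (sphere 0 1) :=
    continuousOn_const.inf (continuousOn_const.mul huv)
  have hgc : ContinuousOn g (sphere 0 1) :=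
    ((continuousOn_const.sub hmin).smul hF).add (hmin.smul continuousOn_const)
  have hseg : ∀ z ∈ sphere (0 : Fin d → ℝ) 1, segment ℝ (u z) (g z) ⊆ X.space ∧
      segment ℝ (g z) (F z) ⊆ X.space := by
    intro z hz
    obtain ⟨s, hs, hus, hsu⟩ := exists_support (huX hz)
    have h0 := hus.1 v
    rcases le_or_gt (u z v) (1 / 2) with hle | hgt
    · have hFz := hF1 z hz (by rw [hlab z hz]; simpa using hle)
      have hsub : ∀ x ∈ geomSimplex s, ∀ y ∈ geomSimplex s, segment ℝ x y ⊆ X.space :=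
        fun x hx y hy => ((convex_geomSimplex s).segment_subset hx hy).trans
          (geomSimplex_subset_space hs)
      have hmem : F z ∈ geomSimplex s ∧ g z ∈ geomSimplex s := by
        rcases h0.lt_or_eq with hpos | hzero
        · obtain ⟨t, hts, -, ht⟩ := exists_unlabel_mem hlabel hcard hs hus
            (by rw [hlab z hz]; norm_num; linarith) rfl (by simpa using hpos)
          have hFs : F z ∈ geomSimplex s := hFz ▸ geomSimplex_mono hts ht
          refine ⟨hFs, convex_geomSimplex s hFs (single_mem_geomSimplex ((hsu v).2 hpos)) ?_ ?_ ?_⟩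
          · linarith [min_le_left 1 (2 * u z v)]
          · exact le_min zero_le_one (by linarith)
          · ring
        · rw [unlabel_eq_self] at hFz
          · have : g z = F z := by simp [hg, ← hzero]
            rw [this, hFz]
            exact ⟨hus, hus⟩
          · rintro _ rfl hpos
            have := hpos v (Finset.mem_singleton_self v)
            linarith
      exact ⟨hsub _ hus _ hmem.2, hsub _ hmem.2 _ hmem.1⟩
    · have hgz : g z = Pi.single v 1 := by
        have : min 1 (2 * u z v) = 1 := min_eq_left (by linarith)
        simp [hg, this]
      obtain ⟨t, ht, hFt, -⟩ := exists_support
        (hF2 z hz {v} rfl (by simpa using (by norm_num : (0 : ℝ) < 1 / 2).trans hgt))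
      obtain ⟨hvt, heq⟩ := hvJoin t ht
      obtain ⟨h1, h2, h3⟩ := mem_bdJoin.1 ht
      have hins : insert v t ∈ X.faces := by
        refine mem_bdJoin.2 ⟨Finset.insert_nonempty v t, fun hsub => h2 fun a ha => ?_, ?_⟩
        · refine Finset.mem_of_mem_insert_of_ne (hsub (Finset.mem_insert_of_mem ha)) ?_
          rintro rfl
          exact hvσ ha
        · rwa [Finset.insert_sdiff_of_mem _ (Finset.mem_insert_self v σ), heq]
      rw [hgz]
      constructor
      · exact ((convex_geomSimplex s).segment_subset hus
          (single_mem_geomSimplex ((hsu v).2 (by linarith)))).trans (geomSimplex_subset_space hs)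
      · exact ((convex_geomSimplex _).segment_subset
          (single_mem_geomSimplex (Finset.mem_insert_self v t))
          (geomSimplex_mono (Finset.subset_insert v t) hFt)).trans (geomSimplex_subset_space hins)
  refine exists_extension_of_segment hu hgc (fun z hz => (hseg z hz).1)
    (exists_extension_of_segment hgc hF (fun z hz => (hseg z hz).2)
      (exists_extension_of_segment hF (continuousOn_const (c := Pi.single w (1 : ℝ))) ?_
        ⟨fun _ => Pi.single w 1, continuousOn_const, fun _ _ => hwspace, fun _ _ => rfl⟩))
  intro z hz
  obtain ⟨s, ⟨hs, hvs⟩, hFs, -⟩ := exists_support (hFZ hz)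
  obtain ⟨h1, h2, h3⟩ := mem_bdJoin.1 hs
  have hins : insert w s ∈ X.faces := by
    refine mem_bdJoin.2 ⟨Finset.insert_nonempty w s, fun hsub => ?_, ?_⟩
    · exact hvs (Finset.mem_of_mem_insert_of_ne (hsub (Finset.mem_insert_self v σ)) hvw)
    · rwa [Finset.insert_sdiff_of_mem _ (Finset.mem_insert_of_mem hw)]
  exact ((convex_geomSimplex _).segment_subset (geomSimplex_mono (Finset.subset_insert w s) hFs)
    (single_mem_geomSimplex (Finset.mem_insert_self w s))).trans (geomSimplex_subset_space hins)

theorem sphereExt_bdJoin {G : ASC V} (j : ℕ) : ∀ {σ : Finset V}, σ.card = j + 1 →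
    (∀ s ∈ G.faces, Disjoint σ s) → ∀ {n : ℤ},
    (∀ d : ℕ, (d : ℤ) ≤ n - j → SphereExt G.space d) →
    ∀ d : ℕ, (d : ℤ) ≤ n → SphereExt (bdJoin σ G).space d := by
  induction j with
  | zero =>
    intro σ hσ hdisj n hG d hd
    obtain ⟨v, rfl⟩ := Finset.card_eq_one.1 hσ
    exact sphereExt_bdJoin_singleton hdisj (hG d (by simpa using hd))
  | succ j ih =>
    intro σ hσ hdisj n hG d hd
    obtain ⟨v, τ, hvτ, rfl, hτ⟩ := Finset.card_eq_succ.1 hσ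
    refine sphereExt_bdJoin_insert hvτ (Finset.card_pos.1 (by omega)) hdisj fun e he => ?_
    refine ih (n := n - 1) hτ (fun s hs => (hdisj s hs).mono_left (Finset.subset_insert v τ))
      (fun d hd => hG d ?_) e (by omega)
    push_cast
    omega

/-- The faces of `K` all of whose bad faces have at most `k` vertices. -/
def badFiltration (K : ASC V) (Bad : Set (Finset V)) (k : ℕ) : ASC V :=
  K.restrict (fun s => ∀ t ⊆ s, t ∈ Bad → t.card ≤ k)
    fun _ _ hts hs r hr => hs r (hr.trans hts)

theorem exists_extension_badFiltration_succ {K : ASC V} {Bad : Set (Finset V)} {n : ℤ}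
    (hBad : ∀ s ∈ Bad, s ∈ K.faces)
    (h2 : ∀ s ∈ K.faces, ∀ t u, t ⊆ s → u ⊆ s → t ∈ Bad → u ∈ Bad → t ∪ u ∈ Bad)
    (hG : ∀ σ ∈ Bad, IsConn (↥(goodFor K Bad σ).space) (n - σ.card + 1))
    {d : ℕ} (hd : (d : ℤ) ≤ n + 1) {k : ℕ} {g : (Fin d → ℝ) → V → ℝ}
    (hg : ContinuousOn g (closedBall 0 1))
    (hgX : MapsTo g (closedBall 0 1) (badFiltration K Bad (k + 1)).space) :
    ∃ F : (Fin d → ℝ) → V → ℝ, ContinuousOn F (closedBall 0 1) ∧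
      MapsTo F (closedBall 0 1) (badFiltration K Bad k).space ∧
      ∀ z ∈ closedBall (0 : Fin d → ℝ) 1,
        (∀ σ ∈ Bad, ¬ ∀ v ∈ σ, 0 < g z v) → F z = g z := by
  set S : Set (Finset V) := {σ ∈ Bad | σ.card = k + 1} with hS
  have hlabel : UniqueLabel (badFiltration K Bad (k + 1)) S := by
    refine ⟨fun σ hσ => K.nonempty_of_mem (hBad σ hσ.1), ?_⟩
    rintro s ⟨hs, hsk⟩ σ ⟨hσ, hσk⟩ τ ⟨hτ, hτk⟩ hσs hτs
    have h := hsk _ (Finset.union_subset hσs hτs) (h2 s hs σ τ hσs hτs hσ hτ)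
    exact (Finset.eq_of_subset_of_card_le Finset.subset_union_left (by omega)).trans
      (Finset.eq_of_subset_of_card_le Finset.subset_union_right (by omega)).symm
  obtain ⟨F, hF, hFZ, hF1, -⟩ := exists_compression (Z := badFiltration K Bad k) (e := d)
    hlabel (fun σ hσ => hσ.2) (fun σ => bdJoin σ (goodFor K Bad σ))
    (by
      rintro s ⟨hs, hsk⟩ hsS
      refine ⟨hs, fun t hts ht => ?_⟩
      have h3 := hsk t hts ht
      by_contra h4
      exact hsS t ⟨ht, by omega⟩ hts)
    (by
      rintro σ ⟨hσ, hσk⟩ s hs ⟨hsσ, hsk⟩ hσs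
      refine mem_bdJoin.2 ⟨hs, hσs, fun hne => ⟨⟨?_, Finset.disjoint_sdiff, ?_⟩, ?_⟩⟩
      · exact K.down_closed hsσ (Finset.sdiff_subset.trans Finset.subset_union_left) hne
      · rwa [Finset.union_sdiff_self_eq_union, Finset.union_comm]
      · intro u hu _ huB
        rw [Finset.sdiff_union_self_eq_union] at hu
        have h3 := hsk _ (Finset.union_subset hu Finset.subset_union_right)
          (h2 _ hsσ u σ hu Finset.subset_union_right huB hσ)
        have h4 : σ = u ∪ σ :=
          Finset.eq_of_subset_of_card_le Finset.subset_union_right (by omega)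
        rw [h4]
        exact Finset.subset_union_left)
    (by
      rintro σ ⟨hσ, hσk⟩ s hs
      obtain ⟨hne, hσs, hsG⟩ := mem_bdJoin.1 hs
      have key : s ∈ K.faces ∧ ∀ t ⊆ s, t ∈ Bad → t ⊆ σ := by
        rcases (s \ σ).eq_empty_or_nonempty with h0 | h0
        · have hsub := Finset.sdiff_eq_empty_iff_subset.1 h0
          exact ⟨K.down_closed (hBad σ hσ) hsub hne, fun t ht _ => ht.trans hsub⟩
        · obtain ⟨⟨-, -, h3⟩, h4⟩ := hsG h0
          have hsub : s ⊆ s \ σ ∪ σ := by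
            rw [Finset.sdiff_union_self_eq_union]
            exact Finset.subset_union_left
          exact ⟨K.down_closed h3 (by rwa [Finset.union_comm]) hne, fun t ht htB =>
            h4 t (ht.trans hsub) (K.nonempty_of_mem (hBad t htB)) htB⟩
      refine ⟨key.1, fun t ht htB => ?_⟩
      have hss : t ⊂ σ := (key.2 t ht htB).ssubset_of_ne fun h => hσs (h ▸ ht)
      have := Finset.card_lt_card hss
      omega)
    (isCompact_closedBall (0 : Fin d → ℝ) 1) (fun N hN x hx => gridCell_closedBall hN hx)
    (by
      rintro σ ⟨hσ, hσk⟩ e he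
      refine sphereExt_bdJoin (G := goodFor K Bad σ) k (n := n + 1) hσk (fun s hs => hs.1.2.1)
        (fun e' he' => (hG σ hσ).sphereExt ?_) e (by omega)
      rw [hσk]
      push_cast
      omega) hg hgX
  refine ⟨F, hF, hFZ, fun z hz hzB => ?_⟩
  have hzS : ∀ σ ∈ S, ¬ ∀ v ∈ σ, 0 < g z v := fun σ hσ => hzB σ hσ.1
  rw [hF1 z hz (by rw [labelMin_eq_zero hzS]; norm_num), unlabel_eq_self _ hzS]

theorem exists_extension_badFiltration_zero {K : ASC V} {Bad : Set (Finset V)} {n : ℤ}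
    (hBad : ∀ s ∈ Bad, s ∈ K.faces)
    (h2 : ∀ s ∈ K.faces, ∀ t u, t ⊆ s → u ⊆ s → t ∈ Bad → u ∈ Bad → t ∪ u ∈ Bad)
    (hG : ∀ σ ∈ Bad, IsConn (↥(goodFor K Bad σ).space) (n - σ.card + 1))
    {d : ℕ} (hd : (d : ℤ) ≤ n + 1) {u : (Fin d → ℝ) → V → ℝ}
    (hu : ∀ z ∈ sphere (0 : Fin d → ℝ) 1, ∀ σ ∈ Bad, ¬ ∀ v ∈ σ, 0 < u z v) (k : ℕ) :
    (∃ g : (Fin d → ℝ) → V → ℝ, ContinuousOn g (closedBall 0 1) ∧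
      MapsTo g (closedBall 0 1) (badFiltration K Bad k).space ∧ EqOn g u (sphere 0 1)) →
    ∃ g : (Fin d → ℝ) → V → ℝ, ContinuousOn g (closedBall 0 1) ∧
      MapsTo g (closedBall 0 1) (badFiltration K Bad 0).space ∧ EqOn g u (sphere 0 1) := by
  induction k with
  | zero => exact id
  | succ k ih =>
    rintro ⟨g, hg, hgX, hgu⟩
    obtain ⟨F, hF, hFX, hFg⟩ := exists_extension_badFiltration_succ hBad h2 hG hd hg hgX
    refine ih ⟨F, hF, hFX, fun z hz => ?_⟩
    rw [hFg z (sphere_subset_closedBall hz) (by rw [hgu hz]; exact hu z hz), hgu hz]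

/-- Restriction of barycentric coordinates to the finite set `T`, normalized. -/
noncomputable def restrictTo (T : Finset V) (x : V → ℝ) : V → ℝ :=
  fun v => if v ∈ T then x v / ∑ w ∈ T, x w else 0

theorem restrictTo_mem {T s : Finset V} {x : V → ℝ} (hx : x ∈ geomSimplex s)
    (hT : 0 < ∑ v ∈ T, x v) : restrictTo T x ∈ geomSimplex (s ∩ T) := by
  refine ⟨fun v => ?_, fun v hv => ?_, ?_⟩
  · rw [restrictTo]
    split_ifs
    exacts [div_nonneg (hx.1 v) hT.le, le_rfl]
  · rw [restrictTo]
    split_ifs with h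
    · rw [hx.2.1 v fun hvs => hv (Finset.mem_inter.2 ⟨hvs, h⟩), zero_div]
    · rfl
  · have h1 : ∑ v ∈ s ∩ T, restrictTo T x v = ∑ v ∈ T, x v / ∑ w ∈ T, x w := by
      rw [← Finset.sum_subset (Finset.inter_subset_right (s₁ := s) (s₂ := T))]
      · exact Finset.sum_congr rfl fun v hv => if_pos (Finset.mem_inter.1 hv).2
      · intro v hv hvn
        rw [hx.2.1 v fun hvs => hvn (Finset.mem_inter.2 ⟨hvs, hv⟩), zero_div]
    rw [h1, ← Finset.sum_div, div_self hT.ne']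

theorem continuousOn_restrictTo (T : Finset V) :
    ContinuousOn (restrictTo T) {x : V → ℝ | 0 < ∑ v ∈ T, x v} := by
  refine continuousOn_pi.2 fun v => ?_
  by_cases h : v ∈ T
  · simp only [restrictTo, if_pos h]
    exact (continuous_apply v).continuousOn.div (by fun_prop) fun x hx => ne_of_gt hx
  · simp only [restrictTo, if_neg h]
    exact continuousOn_const

theorem sphereExt_of_bad {K L : ASC V} (hLK : L.faces ⊆ K.faces)
    {Bad : Set (Finset V)} (hBad : ∀ s ∈ Bad, s ∈ K.faces ∧ s ∉ L.faces)
    (h1 : ∀ s ∈ K.faces, (∀ t, t ⊆ s → t.Nonempty → t ∉ Bad) → s ∈ L.faces)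
    (h2 : ∀ s ∈ K.faces, ∀ t u, t ⊆ s → u ⊆ s → t ∈ Bad → u ∈ Bad → t ∪ u ∈ Bad)
    {n : ℤ} (hG : ∀ σ ∈ Bad, IsConn (↥(goodFor K Bad σ).space) (n - σ.card + 1))
    {d : ℕ} (hd : (d : ℤ) ≤ n + 1) (hK : SphereExt K.space d) : SphereExt L.space d := by
  intro u hu huL
  obtain ⟨g, hg, hgK, hgu⟩ := hK u hu fun z hz => ASC.space_mono hLK (huL hz)
  obtain ⟨T, hT⟩ := exists_finset_sum_pos (isCompact_closedBall 0 1) hg hgK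
  have hTu : ∀ z ∈ sphere (0 : Fin d → ℝ) 1, 0 < ∑ v ∈ T, u z v := fun z hz => by
    simpa only [hgu hz] using hT z (sphere_subset_closedBall hz)
  have hrestrict : ∀ M : ASC V, ∀ x ∈ M.space, 0 < ∑ v ∈ T, x v →
      ∃ s ∈ M.faces, x ∈ geomSimplex s ∧ restrictTo T x ∈ geomSimplex (s ∩ T) ∧
        s ∩ T ∈ M.faces := by
    intro M x hx hxT
    obtain ⟨s, hs, hxs, -⟩ := exists_support hx
    have h := restrictTo_mem hxs hxT
    exact ⟨s, hs, hxs, h,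
      M.down_closed hs Finset.inter_subset_left (nonempty_of_mem_geomSimplex h)⟩
  have huc : ContinuousOn (fun z => restrictTo T (u z)) (sphere 0 1) :=
    (continuousOn_restrictTo T).comp hu hTu
  refine exists_extension_of_segment hu huc (fun z hz => ?_) ?_
  · obtain ⟨s, hs, hus, hr, -⟩ := hrestrict L _ (huL hz) (hTu z hz)
    exact ((convex_geomSimplex s).segment_subset hus
      (geomSimplex_mono Finset.inter_subset_left hr)).trans (geomSimplex_subset_space hs)
  · have huB : ∀ z ∈ sphere (0 : Fin d → ℝ) 1, ∀ σ ∈ Bad, ¬ ∀ v ∈ σ, 0 < restrictTo T (u z) v := by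
      intro z hz σ hσ hpos
      obtain ⟨s, hs, -, hr, -⟩ := hrestrict L _ (huL hz) (hTu z hz)
      refine (hBad σ hσ).2 (L.down_closed hs (fun v hv => ?_) (K.nonempty_of_mem (hBad σ hσ).1))
      by_contra hvs
      exact (hpos v hv).ne' (hr.2.1 v fun h => hvs (Finset.mem_inter.1 h).1)
    have hgX : MapsTo (fun z => restrictTo T (g z)) (closedBall 0 1)
        (badFiltration K Bad T.card).space := by
      intro z hz
      obtain ⟨s, -, -, hr, hsK⟩ := hrestrict K _ (hgK hz) (hT z hz)
      exact geomSimplex_subset_space (K := badFiltration K Bad T.card) ⟨hsK, fun t ht _ =>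
        Finset.card_le_card (ht.trans Finset.inter_subset_right)⟩ hr
    obtain ⟨F, hF, hFX, hFu⟩ := exists_extension_badFiltration_zero (fun s hs => (hBad s hs).1) h2
      hG hd huB T.card ⟨fun z => restrictTo T (g z), (continuousOn_restrictTo T).comp hg hT, hgX,
        fun z hz => by simp only [hgu hz]⟩
    refine ⟨F, hF, fun z hz => ASC.space_mono ?_ (hFX hz), hFu⟩
    rintro s ⟨hs, hs0⟩
    refine h1 s hs fun t hts hne htB => ?_
    have := hs0 t hts htB
    exact hne.ne_empty (Finset.card_eq_zero.1 (by omega))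

end LinkArgument

/-- Link argument, version (a): if `X` is `n`-connected and `G_σ` is `(n − dim σ)`-connected
for every bad simplex `σ`, then the subcomplex `Y` is `n`-connected. -/
theorem link_argument_down {V : Type} [DecidableEq V] (K L : ASC V) (hLK : L.faces ⊆ K.faces)
    (Bad : Set (Finset V)) (hBad : ∀ s ∈ Bad, s ∈ K.faces ∧ s ∉ L.faces)
    (h1 : ∀ s ∈ K.faces, (∀ t, t ⊆ s → t.Nonempty → t ∉ Bad) → s ∈ L.faces)
    (h2 : ∀ s ∈ K.faces, ∀ t u, t ⊆ s → u ⊆ s → t ∈ Bad → u ∈ Bad → t ∪ u ∈ Bad)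
    (n : ℤ) (hX : IsConn (↥K.space) n)
    (hG : ∀ σ ∈ Bad, IsConn (↥(goodFor K Bad σ).space) (n - σ.card + 1)) :
    IsConn (↥L.space) n := by
  exact isConn_of_sphereExt (fun d hd =>
    sphereExt_of_bad hLK hBad h1 h2 hG hd (hX.sphereExt hd)) inferInstance
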